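/- Let Ω ⊊ ℂ̂ be a simply connected domain in the Riemann sphere whose complement contains at least two points and whose boundary ∂Ω is locally connected. Let f : Ω̄ → ℂ̂ be a continuous map such that f is meromorphic on Ω and f(z) = ι(z) for every z ∈ ∂Ω. Then there exists a rational map R : ℂ̂ → ℂ̂ such that R is injective on the open unit disk 𝔻, R(𝔻) = Ω, and ι ∘ f = R ∘ η⁻ ∘ (R|_𝔻)⁻¹ on Ω; that is, for every z ∈ Ω, ι(f(z)) = R(η⁻(w)) where w is the unique point of 𝔻 with R(w) = z. -/

import Mathlib

open OnePoint Filter Topology Classical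

/-- The involution `η(z) = 1/z` of the Riemann sphere `ℂ̂ = ℂ ∪ {∞}`. -/
noncomputable def sphereInv : OnePoint ℂ → OnePoint ℂ
  | ∞ => ((0 : ℂ) : OnePoint ℂ)
  | (z : ℂ) => if z = 0 then ∞ else ((z⁻¹ : ℂ) : OnePoint ℂ)

/-- Complex conjugation `ι(z) = z̄` extended to the Riemann sphere by `ι(∞) = ∞`. -/
def sphereConj : OnePoint ℂ → OnePoint ℂ
  | ∞ => ∞
  | (z : ℂ) => (((starRingEnd ℂ) z : ℂ) : OnePoint ℂ)

/-- The anti-holomorphic involution `η⁻(z) = 1/z̄` of the Riemann sphere. -/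
noncomputable def sphereInvConj : OnePoint ℂ → OnePoint ℂ := sphereInv ∘ sphereConj

/-- The chart parametrization of the Riemann sphere at a point `p`: the identity chart
`w ↦ w` if `p` is finite, and the inverted chart `w ↦ 1/w` (sending `0 ↦ ∞`) if `p = ∞`. -/
noncomputable def sphereChart (p : OnePoint ℂ) : ℂ → OnePoint ℂ :=
  if p = (∞ : OnePoint ℂ) then (fun w => sphereInv ((w : ℂ) : OnePoint ℂ)) else (fun w => ((w : ℂ) : OnePoint ℂ))

/-- The coordinate of a point of the Riemann sphere in its chart: `z` for a finite point
`z`, and `0` for `∞`. -/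
def sphereCoord : OnePoint ℂ → ℂ
  | ∞ => 0
  | (z : ℂ) => z

/-- A self-map of the Riemann sphere is holomorphic at `p` if, read in the charts at `p`
and at `f p`, it is given near `p` by a function of one complex variable that is
analytic at the coordinate of `p`. -/
def SphereHolomorphicAt (f : OnePoint ℂ → OnePoint ℂ) (p : OnePoint ℂ) : Prop :=
  ∃ g : ℂ → ℂ, AnalyticAt ℂ g (sphereCoord p) ∧
    ∀ᶠ w in 𝓝 (sphereCoord p), f (sphereChart p w) = sphereChart (f p) (g w)

/-- A rational map: a nonconstant holomorphic self-map of the Riemann sphere. -/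
def IsRationalMap (R : OnePoint ℂ → OnePoint ℂ) : Prop :=
  (∀ p, SphereHolomorphicAt R p) ∧ ∀ c, R ≠ fun _ => c

/-- The open unit disk `𝔻`, regarded as a subset of the Riemann sphere. -/
def sphereUnitDisk : Set (OnePoint ℂ) := (fun z : ℂ => ((z : ℂ) : OnePoint ℂ)) '' Metric.ball 0 1

@[simp] lemma sphereInv_infty : sphereInv ∞ = ((0 : ℂ) : OnePoint ℂ) := rfl

lemma sphereInv_coe (z : ℂ) :
    sphereInv (z : OnePoint ℂ) = if z = 0 then ∞ else ((z⁻¹ : ℂ) : OnePoint ℂ) := rfl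

@[simp] lemma sphereInv_zero : sphereInv ((0 : ℂ) : OnePoint ℂ) = ∞ := by simp [sphereInv_coe]

lemma sphereInv_coe_of_ne {z : ℂ} (hz : z ≠ 0) :
    sphereInv (z : OnePoint ℂ) = ((z⁻¹ : ℂ) : OnePoint ℂ) := by simp [sphereInv_coe, hz]

@[simp] lemma sphereInv_sphereInv (p : OnePoint ℂ) : sphereInv (sphereInv p) = p := by
  induction p using OnePoint.rec with
  | infty => simp
  | coe z =>
    by_cases hz : z = 0
    · simp [hz]
    · rw [sphereInv_coe_of_ne hz, sphereInv_coe_of_ne (inv_ne_zero hz), inv_inv]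

@[simp] lemma sphereConj_infty : sphereConj ∞ = ∞ := rfl

@[simp] lemma sphereConj_coe (z : ℂ) :
    sphereConj (z : OnePoint ℂ) = (((starRingEnd ℂ) z : ℂ) : OnePoint ℂ) := rfl

@[simp] lemma sphereConj_sphereConj (p : OnePoint ℂ) : sphereConj (sphereConj p) = p := by
  induction p using OnePoint.rec <;> simp

lemma sphereConj_sphereInv (p : OnePoint ℂ) :
    sphereConj (sphereInv p) = sphereInv (sphereConj p) := by
  induction p using OnePoint.rec with
  | infty => simp
  | coe z =>
    by_cases hz : z = 0
    · simp [hz]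
    · rw [sphereConj_coe, sphereInv_coe_of_ne hz, sphereInv_coe_of_ne (by simpa using hz)]
      simp

lemma sphereInvConj_apply (p : OnePoint ℂ) : sphereInvConj p = sphereInv (sphereConj p) := rfl

lemma sphereInvConj_sphereInvConj (p : OnePoint ℂ) : sphereInvConj (sphereInvConj p) = p := by
  simp [sphereInvConj_apply, sphereConj_sphereInv]

@[simp] lemma sphereCoord_infty : sphereCoord ∞ = 0 := rfl

@[simp] lemma sphereCoord_coe (z : ℂ) : sphereCoord (z : OnePoint ℂ) = z := rfl

lemma sphereChart_infty_apply (w : ℂ) : sphereChart ∞ w = sphereInv (w : OnePoint ℂ) := by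
  simp [sphereChart]

@[simp] lemma sphereChart_coe_apply (z w : ℂ) : sphereChart (z : OnePoint ℂ) w = w := by
  simp [sphereChart]

@[simp] lemma sphereChart_sphereCoord (p : OnePoint ℂ) : sphereChart p (sphereCoord p) = p := by
  induction p using OnePoint.rec <;> simp [sphereChart_infty_apply]

lemma sphereChart_injective (p : OnePoint ℂ) : Function.Injective (sphereChart p) := by
  induction p using OnePoint.rec with
  | infty =>
    intro a b hab
    rw [sphereChart_infty_apply, sphereChart_infty_apply] at hab
    simpa using congrArg sphereInv hab
  | coe z =>
    intro a b hab
    simpa using hab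

lemma map_sphereChart_nhds (p : OnePoint ℂ) :
    map (sphereChart p) (𝓝 (sphereCoord p)) = 𝓝 p := by
  induction p using OnePoint.rec with
  | infty =>
    have h1 : 𝓝 (0 : ℂ) = 𝓝[≠] 0 ⊔ pure 0 := by rw [sup_comm, pure_sup_nhdsNE]
    have h2 : map (sphereChart ∞) (𝓝[≠] (0 : ℂ)) =
        map ((↑) : ℂ → OnePoint ℂ) (coclosedCompact ℂ) := by
      rw [coclosedCompact_eq_cocompact, ← Metric.cobounded_eq_cocompact, ← inv_nhdsNE_zero,
        ← Filter.map_inv, Filter.map_map]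
      apply Filter.map_congr
      filter_upwards [self_mem_nhdsWithin] with w hw
      simp only [Set.mem_compl_iff, Set.mem_singleton_iff] at hw
      rw [sphereChart_infty_apply, sphereInv_coe_of_ne hw]
      rfl
    rw [sphereCoord_infty, h1, Filter.map_sup, h2, Filter.map_pure, sphereChart_infty_apply,
      sphereInv_zero, ← OnePoint.nhds_infty_eq]
  | coe z =>
    have : sphereChart (z : OnePoint ℂ) = ((↑) : ℂ → OnePoint ℂ) := by
      ext w; simp
    rw [this, sphereCoord_coe, OnePoint.nhds_coe_eq]

lemma tendsto_sphereChart (p : OnePoint ℂ) :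
    Tendsto (sphereChart p) (𝓝 (sphereCoord p)) (𝓝 p) := (map_sphereChart_nhds p).le

lemma eventually_sphereChart {p : OnePoint ℂ} {P : OnePoint ℂ → Prop} (h : ∀ᶠ q in 𝓝 p, P q) :
    ∀ᶠ w in 𝓝 (sphereCoord p), P (sphereChart p w) :=
  (tendsto_sphereChart p).eventually h

namespace SphereHolomorphicAt

variable {f g : OnePoint ℂ → OnePoint ℂ} {p : OnePoint ℂ}

lemma continuousAt (hf : SphereHolomorphicAt f p) : ContinuousAt f p := by
  obtain ⟨g, hg, hfg⟩ := hf
  have h0 : g (sphereCoord p) = sphereCoord (f p) := by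
    apply sphereChart_injective (f p)
    rw [← hfg.self_of_nhds]; simp
  rw [ContinuousAt, ← map_sphereChart_nhds p, tendsto_map'_iff]
  refine Tendsto.congr' (EventuallyEq.symm hfg) ?_
  refine (tendsto_sphereChart (f p)).comp ?_
  rw [← h0]
  exact hg.continuousAt

lemma comp (hg : SphereHolomorphicAt g (f p)) (hf : SphereHolomorphicAt f p) :
    SphereHolomorphicAt (g ∘ f) p := by
  obtain ⟨F, hF, hfF⟩ := hf
  obtain ⟨G, hG, hgG⟩ := hg
  have h0 : F (sphereCoord p) = sphereCoord (f p) := by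
    apply sphereChart_injective (f p)
    rw [← hfF.self_of_nhds]; simp
  refine ⟨G ∘ F, AnalyticAt.comp (by rwa [h0]) hF, ?_⟩
  have hFc : Tendsto F (𝓝 (sphereCoord p)) (𝓝 (sphereCoord (f p))) := by
    rw [← h0]; exact hF.continuousAt
  filter_upwards [hfF, hFc.eventually hgG] with w h1 h2
  simp only [Function.comp_apply]
  rw [h1, h2]

lemma congr (hf : SphereHolomorphicAt f p) (h : g =ᶠ[𝓝 p] f) : SphereHolomorphicAt g p := by
  obtain ⟨F, hF, hfF⟩ := hf
  refine ⟨F, hF, ?_⟩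
  filter_upwards [hfF, eventually_sphereChart h] with w h1 h2
  rw [h2, h1, h.self_of_nhds]

lemma of_coe {F : ℂ → ℂ} {z : ℂ} (hF : AnalyticAt ℂ F z)
    (h : ∀ᶠ w : ℂ in 𝓝 z, f (w : OnePoint ℂ) = (F w : OnePoint ℂ)) :
    SphereHolomorphicAt f (z : OnePoint ℂ) := by
  refine ⟨F, hF, ?_⟩
  rw [h.self_of_nhds]
  simpa using h

lemma analyticAt_sphereCoord {z : ℂ} (hf : SphereHolomorphicAt f (z : OnePoint ℂ))
    (h : f (z : OnePoint ℂ) ≠ ∞) : AnalyticAt ℂ (fun w : ℂ => sphereCoord (f w)) z := by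
  obtain ⟨F, hF, hfF⟩ := hf
  obtain ⟨c, hc⟩ := OnePoint.ne_infty_iff_exists.1 h
  rw [← hc] at hfF
  simp only [sphereCoord_coe, sphereChart_coe_apply] at hfF hF
  refine hF.congr ?_
  filter_upwards [hfF] with w hw
  rw [hw, sphereCoord_coe]

end SphereHolomorphicAt

lemma sphereHolomorphicAt_sphereInv (p : OnePoint ℂ) : SphereHolomorphicAt sphereInv p := by
  induction p using OnePoint.rec with
  | infty => exact ⟨id, analyticAt_id, by simp [sphereChart_infty_apply]⟩
  | coe z =>
    by_cases hz : z = 0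
    · exact ⟨id, analyticAt_id, by simp [hz, sphereChart_infty_apply]⟩
    · refine .of_coe (F := fun w => w⁻¹) (analyticAt_inv hz) ?_
      filter_upwards [isOpen_ne.mem_nhds (show z ≠ 0 from hz)] with w hw
      exact sphereInv_coe_of_ne hw

/-- The translation `z ↦ z + a` of the Riemann sphere. -/
noncomputable def sphereTranslate (a : ℂ) : OnePoint ℂ → OnePoint ℂ := OnePoint.map (· + a)

@[simp] lemma sphereTranslate_infty (a : ℂ) : sphereTranslate a ∞ = ∞ := rfl

@[simp] lemma sphereTranslate_coe (a z : ℂ) :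
    sphereTranslate a (z : OnePoint ℂ) = ((z + a : ℂ) : OnePoint ℂ) := rfl

lemma sphereTranslate_sphereTranslate_neg (a : ℂ) (p : OnePoint ℂ) :
    sphereTranslate a (sphereTranslate (-a) p) = p := by
  induction p using OnePoint.rec <;> simp

lemma sphereTranslate_neg_sphereTranslate (a : ℂ) (p : OnePoint ℂ) :
    sphereTranslate (-a) (sphereTranslate a p) = p := by
  induction p using OnePoint.rec <;> simp

lemma sphereConj_sphereTranslate (a : ℂ) (p : OnePoint ℂ) :
    sphereConj (sphereTranslate a p) = sphereTranslate ((starRingEnd ℂ) a) (sphereConj p) := by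
  induction p using OnePoint.rec <;> simp

lemma sphereHolomorphicAt_sphereTranslate (a : ℂ) (p : OnePoint ℂ) :
    SphereHolomorphicAt (sphereTranslate a) p := by
  induction p using OnePoint.rec with
  | infty =>
    have hne : ∀ᶠ w : ℂ in 𝓝 0, 1 + a * w ≠ 0 := by
      have : ContinuousAt (fun w : ℂ => 1 + a * w) 0 := by fun_prop
      exact this.eventually_ne (by simp)
    refine ⟨fun w => w / (1 + a * w), ?_, ?_⟩
    · simp only [sphereCoord_infty]
      refine AnalyticAt.div analyticAt_id (by fun_prop) (by simp)
    · filter_upwards [hne] with w hw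
      simp only [sphereTranslate_infty, sphereChart_infty_apply]
      by_cases h0 : w = 0
      · simp [h0]
      · rw [sphereInv_coe_of_ne h0, sphereInv_coe_of_ne (div_ne_zero h0 hw), sphereTranslate_coe]
        congr 1
        field_simp
  | coe z =>
    refine .of_coe (F := fun w => w + a) (by fun_prop) (by simp)

lemma sphereChart_sphereConj (p : OnePoint ℂ) (w : ℂ) :
    sphereChart (sphereConj p) ((starRingEnd ℂ) w) = sphereConj (sphereChart p w) := by
  induction p using OnePoint.rec <;> simp [sphereChart_infty_apply, sphereConj_sphereInv]

lemma sphereCoord_sphereConj (p : OnePoint ℂ) :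
    sphereCoord (sphereConj p) = (starRingEnd ℂ) (sphereCoord p) := by
  induction p using OnePoint.rec <;> simp

lemma AnalyticAt.conj_conj {F : ℂ → ℂ} {z : ℂ} (hF : AnalyticAt ℂ F z) :
    AnalyticAt ℂ (fun w => (starRingEnd ℂ) (F ((starRingEnd ℂ) w))) ((starRingEnd ℂ) z) := by
  rw [Complex.analyticAt_iff_eventually_differentiableAt] at hF ⊢
  have hc : Tendsto (starRingEnd ℂ) (𝓝 ((starRingEnd ℂ) z)) (𝓝 z) := by
    have := Complex.continuous_conj.tendsto ((starRingEnd ℂ) z)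
    rwa [Complex.conj_conj] at this
  filter_upwards [hc.eventually hF] with w hw
  simpa [Function.comp_def] using DifferentiableAt.conj_conj hw

lemma SphereHolomorphicAt.conj_conj {f : OnePoint ℂ → OnePoint ℂ} {p : OnePoint ℂ}
    (hf : SphereHolomorphicAt f p) :
    SphereHolomorphicAt (sphereConj ∘ f ∘ sphereConj) (sphereConj p) := by
  obtain ⟨F, hF, hfF⟩ := hf
  refine ⟨fun w => (starRingEnd ℂ) (F ((starRingEnd ℂ) w)), ?_, ?_⟩
  · rw [sphereCoord_sphereConj]
    exact hF.conj_conj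
  · rw [sphereCoord_sphereConj]
    have hc : Tendsto (starRingEnd ℂ) (𝓝 ((starRingEnd ℂ) (sphereCoord p)))
        (𝓝 (sphereCoord p)) := by
      have := Complex.continuous_conj.tendsto ((starRingEnd ℂ) (sphereCoord p))
      rwa [Complex.conj_conj] at this
    filter_upwards [hc.eventually hfF] with w hw
    have h1 := sphereChart_sphereConj p ((starRingEnd ℂ) w)
    rw [Complex.conj_conj] at h1
    simp only [Function.comp_apply, h1, sphereConj_sphereConj]
    rw [hw, sphereChart_sphereConj]

/-- Inversion as a self-homeomorphism of the Riemann sphere. -/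
noncomputable def sphereInvHomeomorph : OnePoint ℂ ≃ₜ OnePoint ℂ where
  toFun := sphereInv
  invFun := sphereInv
  left_inv := sphereInv_sphereInv
  right_inv := sphereInv_sphereInv
  continuous_toFun := continuous_iff_continuousAt.2 fun p =>
    (sphereHolomorphicAt_sphereInv p).continuousAt
  continuous_invFun := continuous_iff_continuousAt.2 fun p =>
    (sphereHolomorphicAt_sphereInv p).continuousAt

/-- Translation as a self-homeomorphism of the Riemann sphere. -/
noncomputable def sphereTranslateHomeomorph (a : ℂ) : OnePoint ℂ ≃ₜ OnePoint ℂ where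
  toFun := sphereTranslate a
  invFun := sphereTranslate (-a)
  left_inv := sphereTranslate_neg_sphereTranslate a
  right_inv := sphereTranslate_sphereTranslate_neg a
  continuous_toFun := continuous_iff_continuousAt.2 fun p =>
    (sphereHolomorphicAt_sphereTranslate a p).continuousAt
  continuous_invFun := continuous_iff_continuousAt.2 fun p =>
    (sphereHolomorphicAt_sphereTranslate (-a) p).continuousAt

/-- The Möbius transformation `z ↦ 1 / (z - c)`, which carries `c` to `∞`. -/
noncomputable def spherePoleAt (c : ℂ) : OnePoint ℂ ≃ₜ OnePoint ℂ :=
  (sphereTranslateHomeomorph (-c)).trans sphereInvHomeomorph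

lemma spherePoleAt_apply (c : ℂ) (p : OnePoint ℂ) :
    spherePoleAt c p = sphereInv (sphereTranslate (-c) p) := rfl

lemma spherePoleAt_symm_apply (c : ℂ) (p : OnePoint ℂ) :
    (spherePoleAt c).symm p = sphereTranslate c (sphereInv p) := by
  rw [Homeomorph.symm_apply_eq, spherePoleAt_apply, sphereTranslate_neg_sphereTranslate,
    sphereInv_sphereInv]

@[simp] lemma spherePoleAt_self (c : ℂ) : spherePoleAt c (c : OnePoint ℂ) = ∞ := by
  simp [spherePoleAt_apply]

lemma sphereConj_spherePoleAt (c : ℂ) (p : OnePoint ℂ) :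
    sphereConj (spherePoleAt c p) = spherePoleAt ((starRingEnd ℂ) c) (sphereConj p) := by
  simp [spherePoleAt_apply, sphereConj_sphereInv, sphereConj_sphereTranslate]

lemma sphereHolomorphicAt_spherePoleAt (c : ℂ) (p : OnePoint ℂ) :
    SphereHolomorphicAt (spherePoleAt c) p :=
  (sphereHolomorphicAt_sphereInv _).comp (sphereHolomorphicAt_sphereTranslate (-c) p)

lemma sphereHolomorphicAt_spherePoleAt_symm (c : ℂ) (p : OnePoint ℂ) :
    SphereHolomorphicAt (spherePoleAt c).symm p := by
  have h := (sphereHolomorphicAt_sphereTranslate c (sphereInv p)).comp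
    (sphereHolomorphicAt_sphereInv p)
  have h2 : (⇑(spherePoleAt c).symm) = sphereTranslate c ∘ sphereInv :=
    funext (spherePoleAt_symm_apply c)
  rwa [h2]

/-- A simply connected proper open subset of the plane is mapped by a univalent function to a
set that is not dense. -/
lemma exists_injective_not_dense_image {U : Set ℂ} (hUo : IsOpen U)
    (hUc : IsSimplyConnected U) (hU : U ≠ Set.univ) :
    ∃ f : ℂ → ℂ, Function.Injective f ∧ ¬ Dense (f '' U) ∧ ∀ z ∈ U, deriv f z ≠ 0 := by
  obtain ⟨a, ha⟩ := (Set.ne_univ_iff_exists_notMem U).1 hU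
  obtain ⟨f, hfc, hf⟩ := Complex.exists_continuousOn_pow_eq hUc hUo (g := fun z => z - a)
    (by fun_prop) (by rintro ⟨z, hz, h⟩; exact ha (sub_eq_zero.1 h ▸ hz)) two_ne_zero
  have hinj : Function.Injective f := fun z w h => by
    have h1 : z - a = w - a := by rw [← hf z, ← hf w, h]
    exact sub_left_injective h1
  have hf₀ : ∀ z ∈ U, f z ≠ 0 := by
    intro z hz h
    have h1 := hf z
    rw [h, zero_pow two_ne_zero, eq_comm, sub_eq_zero] at h1
    exact ha (h1 ▸ hz)
  have hdf : ∀ z ∈ U, HasStrictDerivAt f (2 * f z)⁻¹ z := by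
    intro z hz
    refine HasStrictDerivAt.of_local_left_inverse (f := fun w => w ^ 2 + a)
      (hfc.continuousAt (hUo.mem_nhds hz)) ?_ (mul_ne_zero two_ne_zero (hf₀ z hz))
      (.of_forall fun w => by simp [hf])
    simpa using (hasStrictDerivAt_pow 2 (f z)).add_const a
  refine ⟨f, hinj, ?_, fun z hz => ?_⟩
  · obtain ⟨x, hx⟩ := hUc.nonempty
    simp only [Dense, not_forall, mem_closure_iff_frequently, not_frequently]
    refine ⟨-f x, ?_⟩
    have himg : f '' U ∈ 𝓝 (f x) := by
      rw [← (hdf x hx).map_nhds_eq (inv_ne_zero (mul_ne_zero two_ne_zero (hf₀ x hx)))]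
      exact Filter.image_mem_map (hUo.mem_nhds hx)
    rw [nhds_neg, eventually_neg]
    filter_upwards [himg]
    rintro _ ⟨y, hy, rfl⟩ ⟨b, hb, hyb⟩
    obtain rfl : y = b := by
      have h1 : y - a = b - a := by rw [← hf y, ← hf b, hyb, neg_sq]
      exact sub_left_injective h1
    exact hf₀ y hy (self_eq_neg.1 hyb)
  · rw [(hdf z hz).hasDerivAt.deriv]
    exact inv_ne_zero (mul_ne_zero two_ne_zero (hf₀ z hz))

lemma exists_mapsTo_unitBall_injOn {U : Set ℂ} (hUo : IsOpen U)
    (hUc : IsSimplyConnected U) (hU : U ≠ Set.univ) :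
    ∃ f : ℂ → ℂ, Set.MapsTo f U (Metric.ball 0 1) ∧ Set.InjOn f U ∧ ∀ z ∈ U, deriv f z ≠ 0 := by
  obtain ⟨f, hinj, hfd, hdf⟩ := exists_injective_not_dense_image hUo hUc hU
  obtain ⟨x, ε, hε₀, hε⟩ : ∃ (x : ℂ) (ε : ℝ), 0 < ε ∧ ∀ a ∈ U, ε < dist (f a) x := by
    simpa [Dense, mem_closure_iff_nhds_basis Metric.nhds_basis_closedBall] using hfd
  have hfx : ∀ z ∈ U, f z ≠ x := fun z hz => by simpa using hε₀.trans (hε z hz)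
  refine ⟨fun z => ε / (f z - x), fun z hz => ?_, fun z hz w hw heq => ?_, fun z hz => ?_⟩
  · rw [mem_ball_zero_iff, norm_div, Complex.norm_real, Real.norm_of_nonneg hε₀.le, div_lt_one₀]
    · simpa [dist_eq_norm] using hε z hz
    · simpa [sub_eq_zero] using hfx z hz
  · simpa [div_eq_mul_inv, hε₀.ne', hinj.eq_iff] using heq
  · have hdz : DifferentiableAt ℂ f z := differentiableAt_of_deriv_ne_zero (hdf z hz)
    rw [(hasDerivAt_const _ _).fun_div (hdz.hasDerivAt.sub_const _) _ |>.deriv] <;>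
      simp [*, ne_of_gt, sub_eq_zero]
/-- The disk automorphism `z ↦ (z - c) / (1 - c̄ z)`. -/
noncomputable def diskShift (c z : ℂ) : ℂ := (z - c) / (1 - (starRingEnd ℂ) c * z)

lemma one_sub_conj_mul_ne_zero {c z : ℂ} (hc : ‖c‖ < 1) (hz : ‖z‖ < 1) :
    1 - (starRingEnd ℂ) c * z ≠ 0 := by
  intro h
  have h1 : (starRingEnd ℂ) c * z = 1 := (sub_eq_zero.1 h).symm
  have h2 : ‖c‖ * ‖z‖ = 1 := by
    have := congrArg norm h1
    simpa using this
  nlinarith [norm_nonneg c, norm_nonneg z]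

lemma norm_diskShift_lt_one {c z : ℂ} (hc : ‖c‖ < 1) (hz : ‖z‖ < 1) : ‖diskShift c z‖ < 1 := by
  have h0 := one_sub_conj_mul_ne_zero hc hz
  rw [diskShift, norm_div, div_lt_one (norm_pos_iff.2 h0)]
  refine lt_of_pow_lt_pow_left₀ 2 (norm_nonneg _) ?_
  have hc2 : ‖c‖ ^ 2 < 1 := by nlinarith [norm_nonneg c]
  have hz2 : ‖z‖ ^ 2 < 1 := by nlinarith [norm_nonneg z]
  have key : ‖1 - (starRingEnd ℂ) c * z‖ ^ 2 - ‖z - c‖ ^ 2 = (1 - ‖c‖ ^ 2) * (1 - ‖z‖ ^ 2) := by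
    simp only [Complex.sq_norm, Complex.normSq_apply, Complex.sub_re, Complex.sub_im,
      Complex.mul_re, Complex.mul_im, Complex.conj_re, Complex.conj_im, Complex.one_re,
      Complex.one_im]
    ring
  nlinarith [mul_pos (sub_pos.2 hc2) (sub_pos.2 hz2)]

@[simp] lemma diskShift_self (c : ℂ) : diskShift c c = 0 := by simp [diskShift]

lemma hasDerivAt_diskShift {c z : ℂ} (hc : ‖c‖ < 1) (hz : ‖z‖ < 1) :
    HasDerivAt (diskShift c)
      ((1 - (starRingEnd ℂ) c * c) / (1 - (starRingEnd ℂ) c * z) ^ 2) z := by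
  have h0 := one_sub_conj_mul_ne_zero hc hz
  have h1 : HasDerivAt (fun z : ℂ => z - c) 1 z := (hasDerivAt_id z).sub_const c
  have h2 : HasDerivAt (fun z : ℂ => 1 - (starRingEnd ℂ) c * z) (-((starRingEnd ℂ) c * 1)) z :=
    ((hasDerivAt_id z).const_mul _).const_sub 1
  refine (h1.div h2 h0).congr_deriv ?_
  congr 1
  ring

lemma diskShift_eq_zero {c z : ℂ} (hc : ‖c‖ < 1) (hz : ‖z‖ < 1) (h : diskShift c z = 0) :
    z = c := by
  rw [diskShift, div_eq_zero_iff] at h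
  exact sub_eq_zero.1 (h.resolve_right (one_sub_conj_mul_ne_zero hc hz))

lemma one_sub_conj_mul_self_ne_zero {c : ℂ} (hc : ‖c‖ < 1) : 1 - (starRingEnd ℂ) c * c ≠ 0 :=
  one_sub_conj_mul_ne_zero hc hc

lemma diskShift_injOn {c : ℂ} (hc : ‖c‖ < 1) : Set.InjOn (diskShift c) (Metric.ball 0 1) := by
  intro z hz w hw h
  rw [mem_ball_zero_iff] at hz hw
  have h1 := one_sub_conj_mul_ne_zero hc hz
  have h2 := one_sub_conj_mul_ne_zero hc hw
  rw [diskShift, diskShift, div_eq_div_iff h1 h2] at h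
  have h3 : (z - w) * (1 - (starRingEnd ℂ) c * c) = 0 := by linear_combination h
  rcases mul_eq_zero.1 h3 with h4 | h4
  · exact sub_eq_zero.1 h4
  · exact absurd h4 (one_sub_conj_mul_self_ne_zero hc)

/-- Univalent maps of `U` into the unit disk, with nowhere vanishing derivative, that send `z₀`
to `0`: the competitors in the extremal problem behind the Riemann mapping theorem. -/
structure IsDiskEmbedding (U : Set ℂ) (z₀ : ℂ) (F : ℂ → ℂ) : Prop where
  differentiableOn : DifferentiableOn ℂ F U
  mapsTo : Set.MapsTo F U (Metric.ball 0 1)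
  injOn : Set.InjOn F U
  deriv_ne_zero : ∀ z ∈ U, deriv F z ≠ 0
  map_base : F z₀ = 0

lemma isDiskEmbedding_diskShift_comp {U : Set ℂ} {z₀ : ℂ} {F : ℂ → ℂ} (hU : IsOpen U)
    (hz₀ : z₀ ∈ U) (hd : DifferentiableOn ℂ F U) (hm : Set.MapsTo F U (Metric.ball 0 1))
    (hi : Set.InjOn F U) (hF : ∀ z ∈ U, deriv F z ≠ 0) :
    IsDiskEmbedding U z₀ (diskShift (F z₀) ∘ F) := by
  have hn : ∀ z ∈ U, ‖F z‖ < 1 := fun z hz => by simpa using hm hz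
  have hder : ∀ z ∈ U, HasDerivAt (diskShift (F z₀) ∘ F) _ z := fun z hz =>
    (hasDerivAt_diskShift (hn z₀ hz₀) (hn z hz)).comp z
      (hd.differentiableAt (hU.mem_nhds hz)).hasDerivAt
  refine ⟨fun z hz => (hder z hz).differentiableAt.differentiableWithinAt, fun z hz => ?_,
    (diskShift_injOn (hn z₀ hz₀)).comp hi hm, fun z hz => ?_, by simp⟩
  · simpa using norm_diskShift_lt_one (hn z₀ hz₀) (hn z hz)
  · rw [(hder z hz).deriv]
    exact mul_ne_zero (div_ne_zero (one_sub_conj_mul_self_ne_zero (hn z₀ hz₀))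
      (pow_ne_zero 2 (one_sub_conj_mul_ne_zero (hn z₀ hz₀) (hn z hz)))) (hF z hz)

/-- Koebe's square root step: a disk embedding that omits a point of the disk does not have
the largest derivative at the base point. -/
lemma IsDiskEmbedding.exists_norm_deriv_lt {U : Set ℂ} {z₀ c : ℂ} {F : ℂ → ℂ} (hU : IsOpen U)
    (hUc : IsSimplyConnected U) (hz₀ : z₀ ∈ U) (hF : IsDiskEmbedding U z₀ F) (hc : ‖c‖ < 1)
    (hcF : c ∉ F '' U) :
    ∃ G, IsDiskEmbedding U z₀ G ∧ ‖deriv F z₀‖ < ‖deriv G z₀‖ := by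
  have hn : ∀ z ∈ U, ‖F z‖ < 1 := fun z hz => by simpa using hF.mapsTo hz
  have hder : ∀ z ∈ U, HasDerivAt (diskShift c ∘ F) _ z := fun z hz =>
    (hasDerivAt_diskShift hc (hn z hz)).comp z
      (hF.differentiableOn.differentiableAt (hU.mem_nhds hz)).hasDerivAt
  have hne : ∀ z ∈ U, (diskShift c ∘ F) z ≠ 0 := fun z hz h =>
    hcF ⟨z, hz, diskShift_eq_zero hc (hn z hz) h⟩
  obtain ⟨k, hkc, hk⟩ := Complex.exists_continuousOn_pow_eq hUc hU
    (g := diskShift c ∘ F) (fun z hz => (hder z hz).continuousAt.continuousWithinAt)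
    (by rintro ⟨z, hz, h⟩; exact hne z hz h) two_ne_zero
  have hk0 : ∀ z ∈ U, k z ≠ 0 := fun z hz h => hne z hz (by rw [← hk z, h]; simp)
  have hkder : ∀ z ∈ U, HasDerivAt k (deriv (diskShift c ∘ F) z / (2 * k z)) z := by
    intro z hz
    have hs : HasStrictDerivAt (fun w : ℂ => w ^ 2) (2 * k z) (k z) := by
      simpa using hasStrictDerivAt_pow 2 (k z)
    have h2 : (2 * k z) ≠ 0 := mul_ne_zero two_ne_zero (hk0 z hz)
    have hloc := hs.eventually_left_inverse h2
    have hkz : ContinuousAt k z := hkc.continuousAt (hU.mem_nhds hz)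
    have h3 : HasDerivAt (hs.localInverse _ _ _ h2) (2 * k z)⁻¹ ((diskShift c ∘ F) z) := by
      have := (hs.to_localInverse h2).hasDerivAt
      simpa only [hk z] using this
    have h4 := h3.comp z (hder z hz).differentiableAt.hasDerivAt
    refine (h4.congr_of_eventuallyEq ?_).congr_deriv (by rw [div_eq_mul_inv, mul_comm])
    filter_upwards [hkz.eventually hloc] with w hw
    rw [← hw, hk w]; rfl
  have hkn : ∀ z ∈ U, ‖k z‖ < 1 := by
    intro z hz
    have : ‖k z‖ ^ 2 < 1 := by
      rw [← norm_pow, hk z]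
      exact norm_diskShift_lt_one hc (hn z hz)
    nlinarith [norm_nonneg (k z)]
  have hki : Set.InjOn k U := by
    intro a ha b hb hab
    have h1 : (diskShift c ∘ F) a = (diskShift c ∘ F) b := by rw [← hk a, ← hk b, hab]
    exact (diskShift_injOn hc).comp hF.injOn hF.mapsTo ha hb h1
  have hkd : ∀ z ∈ U, deriv k z ≠ 0 := by
    intro z hz
    rw [(hkder z hz).deriv, (hder z hz).deriv]
    exact div_ne_zero (mul_ne_zero (div_ne_zero (one_sub_conj_mul_self_ne_zero hc)
      (pow_ne_zero 2 (one_sub_conj_mul_ne_zero hc (hn z hz)))) (hF.deriv_ne_zero z hz))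
      (mul_ne_zero two_ne_zero (hk0 z hz))
  refine ⟨_, isDiskEmbedding_diskShift_comp hU hz₀
    (fun z hz => (hkder z hz).differentiableAt.differentiableWithinAt)
    (fun z hz => by simpa using hkn z hz) hki hkd, ?_⟩
  have hG := (hasDerivAt_diskShift (hkn z₀ hz₀) (hkn z₀ hz₀)).comp z₀ (hkder z₀ hz₀)
  rw [hG.deriv, (hder z₀ hz₀).deriv, hF.map_base]
  set t := ‖k z₀‖ with ht
  have ht0 : 0 < t := norm_pos_iff.2 (hk0 z₀ hz₀)
  have ht1 : t < 1 := hkn z₀ hz₀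
  have hct : ‖c‖ = t ^ 2 := by
    rw [ht, ← norm_pow, hk z₀]
    simp [hF.map_base, diskShift]
  have e1 : ∀ a : ℂ, ‖a‖ < 1 → ‖1 - (starRingEnd ℂ) a * a‖ = 1 - ‖a‖ ^ 2 := by
    intro a ha
    have : 1 - (starRingEnd ℂ) a * a = ((1 - ‖a‖ ^ 2 : ℝ) : ℂ) := by
      rw [mul_comm, Complex.mul_conj, Complex.normSq_eq_norm_sq]; push_cast; ring
    rw [this, Complex.norm_real, Real.norm_of_nonneg]
    nlinarith [norm_nonneg a]
  have hD : 0 < ‖deriv F z₀‖ := norm_pos_iff.2 (hF.deriv_ne_zero z₀ hz₀)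
  simp only [norm_mul, norm_div, norm_pow, e1 _ hc, e1 _ ht1, hct, mul_zero, sub_zero,
    one_pow, div_one, Complex.norm_ofNat, ← ht]
  have h5 : 0 < 1 - t ^ 2 := by nlinarith
  have h6 : (1 - t ^ 2) / (1 - t ^ 2) ^ 2 * ((1 - (t ^ 2) ^ 2) * ‖deriv F z₀‖ / (2 * t))
      = ‖deriv F z₀‖ * ((1 + t ^ 2) / (2 * t)) := by
    field_simp
    ring
  rw [h6]
  have h7 : 1 < (1 + t ^ 2) / (2 * t) := by
    rw [lt_div_iff₀ (by positivity)]
    nlinarith [sq_pos_of_pos (sub_pos.2 ht1)]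
  nlinarith

/-- A form of Hurwitz's theorem: near a point where the limit is not locally constant, values
converging to the value of the limit are eventually attained. -/
lemma eventually_exists_eq_of_tendstoLocallyUniformlyOn {ι : Type*} {l : Filter ι} {U V : Set ℂ}
    {F : ι → ℂ → ℂ} {f : ℂ → ℂ} {v : ι → ℂ} {b : ℂ} [l.NeBot] (hU : IsOpen U)
    (hF : ∀ n, DifferentiableOn ℂ (F n) U) (hlim : TendstoLocallyUniformlyOn F f l U)
    (hb : b ∈ U) (hf : ¬ ∀ᶠ z in 𝓝 b, f z = f b) (hV : V ∈ 𝓝 b) (hv : Tendsto v l (𝓝 (f b))) :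
    ∀ᶠ n in l, ∃ x ∈ V, F n x = v n := by
  have hfd : DifferentiableOn ℂ f U :=
    hlim.differentiableOn (Eventually.of_forall hF) hU
  have hfa : AnalyticAt ℂ f b := hfd.analyticAt (hU.mem_nhds hb)
  have hne : ∀ᶠ z in 𝓝[≠] b, f z ≠ f b :=
    (hfa.eventually_eq_or_eventually_ne analyticAt_const).resolve_left hf
  rw [eventually_nhdsWithin_iff] at hne
  obtain ⟨r, hr, hball⟩ := Metric.nhds_basis_closedBall.mem_iff.1
    (Filter.inter_mem (Filter.inter_mem (hU.mem_nhds hb) hV) hne)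
  have hsub : Metric.closedBall b r ⊆ U := fun z hz => (hball hz).1.1
  have hcpt : IsCompact (Metric.closedBall b r) := isCompact_closedBall b r
  have hsph : IsCompact (Metric.sphere b r) := isCompact_sphere b r
  obtain ⟨x₀, hx₀, hmin⟩ := hsph.exists_isMinOn (NormedSpace.sphere_nonempty.2 hr.le)
    (f := fun z => ‖f z - f b‖)
    ((hfd.continuousOn.mono (Metric.sphere_subset_closedBall.trans hsub)).sub
      continuousOn_const).norm
  set m := ‖f x₀ - f b‖ with hm
  have hmpos : 0 < m := by
    rw [hm, norm_pos_iff, sub_ne_zero]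
    refine (hball (Metric.sphere_subset_closedBall hx₀)).2 ?_
    simpa using Metric.ne_of_mem_sphere hx₀ hr.ne'
  have hunif := (tendstoLocallyUniformlyOn_iff_forall_isCompact hU).1 hlim _ hsub hcpt
  rw [Metric.tendstoUniformlyOn_iff] at hunif
  filter_upwards [hunif (m / 8) (by positivity), hv.eventually (Metric.ball_mem_nhds _
    (show 0 < m / 8 by positivity))] with n hn hvn
  have hbn : ‖f b - F n b‖ < m / 8 := by
    simpa [dist_eq_norm] using hn b (Metric.mem_closedBall_self hr.le)
  have hd : DiffContOnCl ℂ (F n) (Metric.ball b r) :=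
    ((hF n).mono (by rwa [closure_ball b hr.ne'])).diffContOnCl
  have himg := hd.ball_subset_image_closedBall (ε := m / 2) hr (fun z hz => by
    have h1 : m ≤ ‖f z - f b‖ := hmin hz
    have h2 : ‖f z - F n z‖ < m / 8 := by
      simpa [dist_eq_norm] using hn z (Metric.sphere_subset_closedBall hz)
    have h3 : f z - f b = (f z - F n z) + (F n z - F n b) - (f b - F n b) := by ring
    have h4 : ‖f z - f b‖ ≤ ‖f z - F n z‖ + ‖F n z - F n b‖ + ‖f b - F n b‖ := by
      rw [h3]
      exact (norm_sub_le _ _).trans (by gcongr; exact norm_add_le _ _)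
    linarith) (by
    intro h
    have han : AnalyticOnNhd ℂ (F n) (Metric.closedBall b r) :=
      ((hF n).analyticOnNhd hU).mono hsub
    have h1 := han.eqOn_of_preconnected_of_eventuallyEq (analyticOnNhd_const (v := F n b))
      (convex_closedBall b r).isPreconnected (Metric.mem_closedBall_self hr.le)
      (h.mono fun z hz => not_not.1 hz) (Metric.sphere_subset_closedBall hx₀)
    have h2 : ‖f x₀ - F n x₀‖ < m / 8 := by
      simpa [dist_eq_norm] using hn x₀ (Metric.sphere_subset_closedBall hx₀)
    rw [h1] at h2
    have h3 : f x₀ - f b = (f x₀ - F n b) - (f b - F n b) := by ring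
    have h4 : m ≤ ‖f x₀ - F n b‖ + ‖f b - F n b‖ := by
      rw [hm, h3]
      exact norm_sub_le _ _
    linarith)
  have hvm : v n ∈ Metric.ball (F n b) (m / 2 / 2) := by
    rw [Metric.mem_ball, dist_eq_norm]
    rw [dist_eq_norm] at hvn
    have : v n - F n b = (v n - f b) + (f b - F n b) := by ring
    rw [this]
    exact (norm_add_le _ _).trans_lt (by linarith)
  obtain ⟨x, hx, hxv⟩ := himg hvm
  exact ⟨x, (hball hx).1.2, hxv⟩

/-- Normality of families of disk-valued holomorphic functions, along an ultrafilter. -/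
lemma exists_tendstoLocallyUniformlyOn_ultrafilter {ι : Type*} (l : Ultrafilter ι) {U : Set ℂ}
    (hU : IsOpen U) {F : ι → ℂ → ℂ} (hF : ∀ n, DifferentiableOn ℂ (F n) U)
    (hm : ∀ n, Set.MapsTo (F n) U (Metric.ball 0 1)) :
    ∃ f, TendstoLocallyUniformlyOn F f (l : Filter ι) U ∧
      Set.MapsTo f U (Metric.closedBall 0 1) := by
  have hpt : ∀ z : ℂ, ∃ y, z ∈ U → y ∈ Metric.closedBall (0 : ℂ) 1 ∧
      Tendsto (fun n => F n z) l (𝓝 y) := by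
    intro z
    by_cases hz : z ∈ U
    · obtain ⟨y, hy, hle⟩ := (isCompact_closedBall (0 : ℂ) 1).ultrafilter_le_nhds
        (l.map fun n => F n z) (by
          rw [Ultrafilter.coe_map, le_principal_iff, mem_map]
          exact Filter.univ_mem' fun n => Metric.ball_subset_closedBall (hm n hz))
      exact ⟨y, fun _ => ⟨hy, hle⟩⟩
    · exact ⟨0, fun h => absurd h hz⟩
  choose f hf using hpt
  refine ⟨f, ?_, fun z hz => (hf z hz).1⟩
  rw [Metric.tendstoLocallyUniformlyOn_iff]
  intro ε hε x hx
  obtain ⟨r, hr, hball⟩ := Metric.isOpen_iff.1 hU x hx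
  have hlip : ∀ n, ∀ y ∈ Metric.ball x r, dist (F n y) (F n x) ≤ 2 / r * dist y x := by
    intro n y hy
    refine Complex.dist_le_div_mul_dist_of_mapsTo_ball ((hF n).mono hball) (fun z hz => ?_) hy
    have h1 : ‖F n z‖ < 1 := by simpa using hm n (hball hz)
    have h2 : ‖F n x‖ < 1 := by simpa using hm n hx
    rw [Metric.mem_closedBall, dist_eq_norm]
    linarith [norm_sub_le (F n z) (F n x)]
  have hflip : ∀ y ∈ Metric.ball x r, dist (f y) (f x) ≤ 2 / r * dist y x := fun y hy =>
    le_of_tendsto (((hf y (hball hy)).2).dist (hf x hx).2)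
      (Eventually.of_forall fun n => hlip n y hy)
  refine ⟨Metric.ball x (min r (ε * r / 8)),
    mem_nhdsWithin_of_mem_nhds (Metric.ball_mem_nhds _ (by positivity)), ?_⟩
  have hx' := (Metric.tendsto_nhds.1 (hf x hx).2) (ε / 4) (by positivity)
  filter_upwards [hx'] with n hn y hy
  have hyr : y ∈ Metric.ball x r := Metric.ball_subset_ball (min_le_left _ _) hy
  have hy2 : dist y x < ε * r / 8 := lt_of_lt_of_le hy (min_le_right _ _)
  have hy3 : 2 / r * dist y x < ε / 4 := by
    have : 2 / r * dist y x < 2 / r * (ε * r / 8) := by gcongr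
    calc _ < _ := this
      _ = ε / 4 := by field_simp; norm_num
  have h1 := hlip n y hyr
  have h2 := hflip y hyr
  have h3 := dist_triangle4 (f y) (f x) (F n x) (F n y)
  rw [dist_comm (f x), dist_comm (F n x) (F n y)] at h3
  linarith

/-- A locally uniform limit of disk embeddings whose derivative at the base point does not vanish
is again a disk embedding. -/
lemma IsDiskEmbedding.of_tendstoLocallyUniformlyOn {ι : Type*} {l : Filter ι} [l.NeBot]
    {U : Set ℂ} {z₀ : ℂ} {F : ι → ℂ → ℂ} {f : ℂ → ℂ} (hU : IsOpen U) (hUc : IsPreconnected U)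
    (hz₀ : z₀ ∈ U) (hF : ∀ n, IsDiskEmbedding U z₀ (F n))
    (hlim : TendstoLocallyUniformlyOn F f l U) (hm : Set.MapsTo f U (Metric.closedBall 0 1))
    (hd : deriv f z₀ ≠ 0) : IsDiskEmbedding U z₀ f := by
  have hFd : ∀ n, DifferentiableOn ℂ (F n) U := fun n => (hF n).differentiableOn
  have hfd : DifferentiableOn ℂ f U := hlim.differentiableOn (Eventually.of_forall hFd) hU
  have hfa : AnalyticOnNhd ℂ f U := hfd.analyticOnNhd hU
  have hnc : ∀ b ∈ U, ∀ c, ¬ ∀ᶠ z in 𝓝 b, f z = c := by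
    intro b hb c h
    have h1 := hfa.eqOn_of_preconnected_of_eventuallyEq analyticOnNhd_const hUc hb h
    have h2 : f =ᶠ[𝓝 z₀] fun _ => c := h1.eventuallyEq_of_mem (hU.mem_nhds hz₀)
    exact hd (by rw [h2.deriv_eq, deriv_const])
  have hdd : TendstoLocallyUniformlyOn (deriv ∘ F) (deriv f) l U :=
    hlim.deriv (Eventually.of_forall hFd) hU
  have hpt : ∀ z ∈ U, Tendsto (fun n => F n z) l (𝓝 (f z)) := fun z hz => hlim.tendsto_at hz
  have hderiv : ∀ z ∈ U, deriv f z ≠ 0 := by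
    intro b hb h0
    by_cases hconst : ∀ᶠ z in 𝓝 b, deriv f z = deriv f b
    · rw [h0] at hconst
      have h1 := (hfa.deriv).eqOn_of_preconnected_of_eventuallyEq
        (analyticOnNhd_const (v := (0 : ℂ))) hUc hb hconst hz₀
      exact hd h1
    · obtain ⟨n, x, hx, hxn⟩ := (eventually_exists_eq_of_tendstoLocallyUniformlyOn hU
        (F := deriv ∘ F) (v := fun _ => 0)
        (fun n => ((hFd n).analyticOnNhd hU).deriv.differentiableOn) hdd hb hconst
        (hU.mem_nhds hb) (by rw [h0]; exact tendsto_const_nhds)).exists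
      exact (hF n).deriv_ne_zero x hx hxn
  refine ⟨hfd, fun z hz => ?_, fun a ha b hb hab => ?_, hderiv, ?_⟩
  · have hs : HasStrictDerivAt f (deriv f z) z := (hfa z hz).hasStrictDerivAt
    have himg : f '' U ∈ 𝓝 (f z) := by
      rw [← hs.map_nhds_eq (hderiv z hz)]
      exact Filter.image_mem_map (hU.mem_nhds hz)
    have h2 : Metric.closedBall (0 : ℂ) 1 ∈ 𝓝 (f z) :=
      Filter.mem_of_superset himg (Set.image_subset_iff.2 hm)
    rwa [← mem_interior_iff_mem_nhds, interior_closedBall _ one_ne_zero] at h2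
  · by_contra hne
    obtain ⟨V, W, hV, hW, hbV, haW, hVW⟩ := t2_separation (Ne.symm hne)
    have h1 := eventually_exists_eq_of_tendstoLocallyUniformlyOn hU hFd hlim hb
      (hnc b hb _) ((hV.inter hU).mem_nhds ⟨hbV, hb⟩)
      (by rw [← hab]; exact hpt a ha)
    obtain ⟨n, x, hx, hxn⟩ := h1.exists
    have h2 := (hF n).injOn hx.2 ha hxn
    exact Set.disjoint_left.1 hVW hx.1 (h2 ▸ haW)
  · refine tendsto_nhds_unique (hpt z₀ hz₀) ?_
    simp only [(hF _).map_base, tendsto_const_nhds]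

/-- The Riemann mapping theorem. -/
theorem exists_isDiskEmbedding_image_eq_ball {U : Set ℂ} {z₀ : ℂ} (hU : IsOpen U)
    (hUc : IsSimplyConnected U) (hne : U ≠ Set.univ) (hz₀ : z₀ ∈ U) :
    ∃ F, IsDiskEmbedding U z₀ F ∧ F '' U = Metric.ball 0 1 := by
  obtain ⟨g, hgm, hgi, hgd⟩ := exists_mapsTo_unitBall_injOn hU hUc hne
  have hg := isDiskEmbedding_diskShift_comp hU hz₀ (fun z hz =>
    (differentiableAt_of_deriv_ne_zero (hgd z hz)).differentiableWithinAt) hgm hgi hgd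
  set S : Set ℝ := {x | ∃ F, IsDiskEmbedding U z₀ F ∧ ‖deriv F z₀‖ = x} with hS
  obtain ⟨r, hr, hball⟩ := Metric.isOpen_iff.1 hU z₀ hz₀
  have hbdd : BddAbove S := by
    refine ⟨1 / r, ?_⟩
    rintro _ ⟨F, hF, rfl⟩
    refine Complex.norm_deriv_le_div_of_mapsTo_ball (hF.differentiableOn.mono hball)
      (fun z hz => ?_) hr
    rw [hF.map_base]
    exact Metric.ball_subset_closedBall (hF.mapsTo (hball hz))
  obtain ⟨u, -, hu, huS⟩ := exists_seq_tendsto_sSup (S := S) ⟨_, _, hg, rfl⟩ hbdd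
  choose F hF hFu using huS
  have hpos : 0 < sSup S :=
    (norm_pos_iff.2 (hg.deriv_ne_zero z₀ hz₀)).trans_le (le_csSup hbdd ⟨_, hg, rfl⟩)
  obtain ⟨f, hlim, hm⟩ := exists_tendstoLocallyUniformlyOn_ultrafilter (hyperfilter ℕ) hU
    (fun n => (hF n).differentiableOn) (fun n => (hF n).mapsTo)
  have hdd := (hlim.deriv (Eventually.of_forall fun n => (hF n).differentiableOn) hU).tendsto_at hz₀
  have hf' : ‖deriv f z₀‖ = sSup S := by
    refine tendsto_nhds_unique hdd.norm ?_
    simp only [Function.comp_apply, hFu]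
    exact hu.mono_left Nat.hyperfilter_le_atTop
  have hf := IsDiskEmbedding.of_tendstoLocallyUniformlyOn hU
    hUc.isPathConnected.isConnected.isPreconnected hz₀ hF hlim hm
    (norm_pos_iff.1 (hf' ▸ hpos))
  refine ⟨f, hf, hf.mapsTo.image_subset.antisymm fun c hc => ?_⟩
  by_contra hcf
  obtain ⟨G, hG, hlt⟩ := hf.exists_norm_deriv_lt hU hUc hz₀ (by simpa using hc) hcf
  exact absurd (le_csSup hbdd ⟨G, hG, rfl⟩) (not_le.2 (hf' ▸ hlt))

/-- The inverse of a Riemann map. -/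
theorem exists_riemann_map {U : Set ℂ} (hU : IsOpen U)
    (hUc : IsSimplyConnected U) (hne : U ≠ Set.univ) :
    ∃ F ψ : ℂ → ℂ, ContinuousOn F U ∧ DifferentiableOn ℂ ψ (Metric.ball 0 1) ∧
      Set.MapsTo F U (Metric.ball 0 1) ∧ Set.MapsTo ψ (Metric.ball 0 1) U ∧
      Set.LeftInvOn ψ F U ∧ Set.LeftInvOn F ψ (Metric.ball 0 1) := by
  obtain ⟨z₀, hz₀⟩ := hUc.nonempty
  obtain ⟨F, hF, himg⟩ := exists_isDiskEmbedding_image_eq_ball hU hUc hne hz₀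
  have hbij : Set.BijOn F U (Metric.ball 0 1) := ⟨hF.mapsTo, hF.injOn, himg.ge⟩
  have hinv : Set.InvOn (Function.invFunOn F U) F U (Metric.ball 0 1) := hbij.invOn_invFunOn
  have hmaps : Set.MapsTo (Function.invFunOn F U) (Metric.ball 0 1) U :=
    hbij.surjOn.mapsTo_invFunOn
  refine ⟨F, Function.invFunOn F U, hF.differentiableOn.continuousOn, fun w hw => ?_, hF.mapsTo,
    hmaps, hinv.1, hinv.2⟩
  have hz := hmaps hw
  set z := Function.invFunOn F U w with hzdef
  have hFz : F z = w := hinv.2 hw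
  have hs : HasStrictDerivAt F (deriv F z) z :=
    (hF.differentiableOn.analyticAt (hU.mem_nhds hz)).hasStrictDerivAt
  have hd := hF.deriv_ne_zero z hz
  have h1 := (hs.to_localInverse hd).hasDerivAt
  rw [hFz] at h1
  refine (h1.differentiableAt.congr_of_eventuallyEq ?_).differentiableWithinAt
  have h2 : ∀ᶠ y in 𝓝 z, y ∈ U ∧ hs.localInverse _ _ _ hd (F y) = y :=
    (show ∀ᶠ y in 𝓝 z, y ∈ U from hU.mem_nhds hz).and (hs.eventually_left_inverse hd)
  have h3 : ∀ᶠ y in 𝓝 z, Function.invFunOn F U (F y) = hs.localInverse _ _ _ hd (F y) := by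
    filter_upwards [h2] with y hy
    rw [hy.2, hinv.1 hy.1]
  rw [← hFz, ← hs.map_nhds_eq hd]
  exact h3

/-- The (unnormalized) Cauchy transform of `f` over the circle of radius `r` around `0`. -/
noncomputable def cauchyTransform (f : ℂ → ℂ) (r : ℝ) (w : ℂ) : ℂ :=
  ∮ ζ in C(0, r), (ζ - w)⁻¹ * f ζ

lemma cauchyTransform_eq_intervalIntegral (f : ℂ → ℂ) (r : ℝ) (w : ℂ) :
    cauchyTransform f r w = ∫ θ in (0 : ℝ)..2 * Real.pi,
      circleMap 0 r θ * Complex.I * ((circleMap 0 r θ - w)⁻¹ * f (circleMap 0 r θ)) := by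
  simp only [cauchyTransform, circleIntegral, deriv_circleMap, smul_eq_mul]

lemma norm_circleMap_sub_ge (r θ : ℝ) (hr : 0 ≤ r) (w : ℂ) :
    |r - ‖w‖| ≤ ‖circleMap 0 r θ - w‖ := by
  have := abs_norm_sub_norm_le (circleMap 0 r θ) w
  rwa [norm_circleMap_zero, abs_of_nonneg hr] at this

lemma continuous_cauchyTransform_integrand {f : ℂ → ℂ} {r : ℝ} (hr : 0 < r) {w : ℂ}
    (hw : ‖w‖ ≠ r) (hf : ∀ ζ, ‖ζ‖ = r → ContinuousAt f ζ) (n : ℕ) :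
    Continuous fun θ : ℝ => circleMap 0 r θ * Complex.I *
      (((circleMap 0 r θ - w) ^ n)⁻¹ * f (circleMap 0 r θ)) := by
  have hne : ∀ θ : ℝ, (circleMap 0 r θ - w) ^ n ≠ 0 := fun θ => by
    refine pow_ne_zero _ (norm_pos_iff.1 ?_)
    exact (abs_pos.2 (sub_ne_zero.2 hw.symm)).trans_le (norm_circleMap_sub_ge r θ hr.le w)
  have hc : Continuous fun θ : ℝ => f (circleMap 0 r θ) := by
    refine continuous_iff_continuousAt.2 fun θ => ?_
    refine ContinuousAt.comp (f := circleMap 0 r) (g := f) (hf _ ?_)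
      (continuous_circleMap 0 r).continuousAt
    rw [norm_circleMap_zero, abs_of_pos hr]
  have h2 : Continuous fun θ : ℝ => ((circleMap 0 r θ - w) ^ n)⁻¹ :=
    (((continuous_circleMap 0 r).sub continuous_const).pow n).inv₀ hne
  exact ((continuous_circleMap 0 r).mul continuous_const).mul (h2.mul hc)

lemma differentiableAt_cauchyTransform {f : ℂ → ℂ} {r : ℝ} (hr : 0 < r) {w : ℂ}
    (hw : ‖w‖ ≠ r) (hf : ∀ ζ, ‖ζ‖ = r → ContinuousAt f ζ) :
    DifferentiableAt ℂ (cauchyTransform f r) w := by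
  have hfun : cauchyTransform f r = fun w => ∫ θ in (0 : ℝ)..2 * Real.pi,
      circleMap 0 r θ * Complex.I * (((circleMap 0 r θ - w) ^ 1)⁻¹ * f (circleMap 0 r θ)) := by
    funext w
    simp only [cauchyTransform_eq_intervalIntegral, pow_one]
  set δ := |r - ‖w‖| / 2 with hδ
  have hδpos : 0 < δ := half_pos (abs_pos.2 (sub_ne_zero.2 hw.symm))
  have hball : ∀ x ∈ Metric.ball w δ, ∀ θ, δ ≤ ‖circleMap 0 r θ - x‖ := by
    intro x hx θ
    have h1 := norm_circleMap_sub_ge r θ hr.le w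
    have h2 : ‖x - w‖ < δ := by rwa [Metric.mem_ball, dist_eq_norm] at hx
    have h3 : ‖circleMap 0 r θ - w‖ ≤ ‖circleMap 0 r θ - x‖ + ‖x - w‖ :=
      norm_sub_le_norm_sub_add_norm_sub _ _ _
    linarith
  have hball2 : ∀ x ∈ Metric.ball w δ, ‖x‖ ≠ r := by
    intro x hx h
    have h1 := norm_circleMap_sub_ge r 0 hr.le w
    have h2 : ‖x - w‖ < δ := by rwa [Metric.mem_ball, dist_eq_norm] at hx
    have h3 := abs_norm_sub_norm_le x w
    rw [h] at h3
    linarith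
  obtain ⟨M, hM⟩ := (isCompact_sphere (0 : ℂ) r).exists_bound_of_continuousOn (f := f)
    (fun ζ hζ => (hf ζ (by simpa using hζ)).continuousWithinAt)
  have hM0 : ∀ θ, ‖f (circleMap 0 r θ)‖ ≤ M := fun θ =>
    hM _ (by simp [abs_of_pos hr])
  rw [hfun]
  refine (intervalIntegral.hasDerivAt_integral_of_dominated_loc_of_deriv_le
    (F' := fun x θ => circleMap 0 r θ * Complex.I *
      (((circleMap 0 r θ - x) ^ 2)⁻¹ * f (circleMap 0 r θ)))
    (bound := fun _ => r * ((δ ^ 2)⁻¹ * M)) (Metric.ball_mem_nhds w hδpos)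
    ?_ ?_ ?_ ?_ ?_ ?_).2.differentiableAt
  · filter_upwards [Metric.ball_mem_nhds w hδpos] with x hx
    exact (continuous_cauchyTransform_integrand hr (hball2 x hx) hf 1).aestronglyMeasurable
  · exact (continuous_cauchyTransform_integrand hr hw hf 1).intervalIntegrable _ _
  · exact (continuous_cauchyTransform_integrand hr hw hf 2).aestronglyMeasurable
  · refine Eventually.of_forall fun θ _ x hx => ?_
    rw [norm_mul, norm_mul, norm_mul, norm_inv, norm_pow, Complex.norm_I, mul_one,
      norm_circleMap_zero, abs_of_pos hr]
    have := hball x hx θ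
    have := hM0 θ
    gcongr
  · exact intervalIntegrable_const
  · refine Eventually.of_forall fun θ _ x hx => ?_
    have hne : circleMap 0 r θ - x ≠ 0 := norm_pos_iff.1 (hδpos.trans_le (hball x hx θ))
    have h1 : HasDerivAt (fun x : ℂ => circleMap 0 r θ - x) (-1) x :=
      (hasDerivAt_id x).const_sub _
    have h2 := ((h1.inv hne).mul_const (f (circleMap 0 r θ))).const_mul
      (circleMap 0 r θ * Complex.I)
    simp only [pow_one]
    refine h2.congr_deriv ?_
    simp [div_eq_mul_inv]

lemma circleIntegral_eq_of_annulus {f : ℂ → ℂ} {r R : ℝ} (hr : 0 < r) (hrR : r ≤ R) (w : ℂ)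
    (hc : ∀ ζ, r ≤ ‖ζ‖ → ‖ζ‖ ≤ R → ContinuousAt f ζ)
    (hf : ∀ ζ, r ≤ ‖ζ‖ → ‖ζ‖ ≤ R → ζ ≠ w → DifferentiableAt ℂ f ζ) :
    (∮ ζ in C(0, R), f ζ) = ∮ ζ in C(0, r), f ζ := by
  refine Complex.circleIntegral_eq_of_differentiable_on_annulus_off_countable hr hrR
    (Set.countable_singleton w) (fun ζ hζ => ?_) (fun ζ hζ => ?_)
  · simp only [Set.mem_sdiff, mem_closedBall_zero_iff, mem_ball_zero_iff, not_lt] at hζ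
    exact (hc ζ hζ.2 hζ.1).continuousWithinAt
  · simp only [Set.mem_sdiff, mem_closedBall_zero_iff, mem_ball_zero_iff, not_le,
      Set.mem_singleton_iff] at hζ
    exact hf ζ hζ.1.2.le hζ.1.1.le hζ.2

lemma cauchyTransform_eq_of_notMem {f : ℂ → ℂ} {r R : ℝ} (hr : 0 < r) (hrR : r ≤ R) {w : ℂ}
    (hf : ∀ ζ, r ≤ ‖ζ‖ → ‖ζ‖ ≤ R → DifferentiableAt ℂ f ζ) (hw : ‖w‖ < r ∨ R < ‖w‖) :
    cauchyTransform f R w = cauchyTransform f r w := by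
  have hd : ∀ ζ, r ≤ ‖ζ‖ → ‖ζ‖ ≤ R →
      DifferentiableAt ℂ (fun ζ => (ζ - w)⁻¹ * f ζ) ζ := by
    intro ζ h1 h2
    have hne : ζ - w ≠ 0 := by
      rw [sub_ne_zero]
      rintro rfl
      rcases hw with h | h <;> linarith
    exact ((differentiableAt_id.sub_const w).inv hne).mul (hf ζ h1 h2)
  exact circleIntegral_eq_of_annulus hr hrR w (fun ζ h1 h2 => (hd ζ h1 h2).continuousAt)
    (fun ζ h1 h2 _ => hd ζ h1 h2)

/-- Cauchy's integral formula on an annulus. -/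
lemma cauchyTransform_sub_cauchyTransform {f : ℂ → ℂ} {r R : ℝ} (hr : 0 < r) {w : ℂ}
    (hf : ∀ ζ, r ≤ ‖ζ‖ → ‖ζ‖ ≤ R → DifferentiableAt ℂ f ζ) (hrw : r < ‖w‖) (hwR : ‖w‖ < R) :
    cauchyTransform f R w - cauchyTransform f r w = 2 * Real.pi * Complex.I * f w := by
  have hR : 0 < R := hr.trans (hrw.trans hwR)
  have key : (∮ ζ in C(0, R), dslope f w ζ) = ∮ ζ in C(0, r), dslope f w ζ := by
    have hd : ∀ ζ, r ≤ ‖ζ‖ → ‖ζ‖ ≤ R → ζ ≠ w → DifferentiableAt ℂ (dslope f w) ζ :=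
      fun ζ h1 h2 h3 => (differentiableAt_dslope_of_ne h3).2 (hf ζ h1 h2)
    refine circleIntegral_eq_of_annulus hr (hrw.trans hwR).le w (fun ζ h1 h2 => ?_) hd
    by_cases h : ζ = w
    · subst h
      exact continuousAt_dslope_same.2 (hf ζ h1 h2)
    · exact (hd ζ h1 h2 h).continuousAt
  have hsplit : ∀ s, 0 < s → s ≠ ‖w‖ → (∀ ζ, ‖ζ‖ = s → ContinuousAt f ζ) →
      (∮ ζ in C(0, s), dslope f w ζ) =
        cauchyTransform f s w - (∮ ζ in C(0, s), (ζ - w)⁻¹) * f w := by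
    intro s hs hsw hfs
    have hne : ∀ ζ ∈ Metric.sphere (0 : ℂ) s, ζ - w ≠ 0 := by
      intro ζ hζ h
      rw [mem_sphere_zero_iff_norm] at hζ
      rw [sub_eq_zero.1 h] at hζ
      exact hsw hζ.symm
    have hi : ContinuousOn (fun ζ : ℂ => (ζ - w)⁻¹) (Metric.sphere 0 s) :=
      (continuousOn_id.sub continuousOn_const).inv₀ hne
    have hfc : ContinuousOn f (Metric.sphere 0 s) := fun ζ hζ =>
      (hfs ζ (by simpa using hζ)).continuousWithinAt
    have h1 : (∮ ζ in C(0, s), dslope f w ζ) =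
        ∮ ζ in C(0, s), ((ζ - w)⁻¹ * f ζ - (ζ - w)⁻¹ * f w) := by
      refine circleIntegral.integral_congr hs.le fun ζ hζ => ?_
      rw [dslope_of_ne f (sub_ne_zero.1 (hne ζ hζ)), slope_def_field]
      simp only [div_eq_mul_inv]
      ring
    rw [h1, circleIntegral.integral_sub (f := fun ζ => (ζ - w)⁻¹ * f ζ)
      (g := fun ζ => (ζ - w)⁻¹ * f w) ((hi.mul hfc).circleIntegrable hs.le)
      ((hi.mul continuousOn_const).circleIntegrable hs.le), cauchyTransform]
    congr 1
    exact circleIntegral.integral_smul_const (fun ζ => (ζ - w)⁻¹) (f w) 0 s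
  rw [hsplit R hR hwR.ne' (fun ζ h => (hf ζ (by linarith) h.le).continuousAt),
    hsplit r hr hrw.ne (fun ζ h => (hf ζ h.ge (by linarith)).continuousAt),
    circleIntegral.integral_sub_inv_of_mem_ball (by simpa using hwR)] at key
  have hzero : (∮ ζ in C(0, r), (ζ - w)⁻¹) = 0 := by
    have hd : ∀ ζ ∈ Metric.closedBall (0 : ℂ) r, DifferentiableAt ℂ (fun ζ => (ζ - w)⁻¹) ζ := by
      intro ζ hζ
      rw [mem_closedBall_zero_iff] at hζ
      refine (differentiableAt_id.sub_const w).inv (sub_ne_zero.2 ?_)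
      rintro h
      simp only [id] at h
      rw [h] at hζ
      linarith
    exact Complex.circleIntegral_eq_zero_of_differentiable_on_off_countable hr.le
      Set.countable_empty (fun ζ hζ => (hd ζ hζ).continuousAt.continuousWithinAt)
      (fun ζ hζ => hd ζ (Metric.ball_subset_closedBall hζ.1))
  rw [hzero] at key
  linear_combination key

lemma circleMap_inv_eq (s θ : ℝ) :
    circleMap 0 s⁻¹ θ = ((starRingEnd ℂ) (circleMap 0 s θ))⁻¹ := by
  rw [circleMap_zero, circleMap_zero, map_mul, Complex.conj_ofReal, ← Complex.exp_conj, mul_inv,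
    ← Complex.exp_neg]
  simp

lemma norm_integrand_sub_le {a b w x y : ℂ} {d C ε t : ℝ} (hd : 0 < d) (ha : d ≤ ‖a - w‖)
    (hb : d ≤ ‖b - w‖) (ha2 : ‖a‖ ≤ 2) (hab : ‖a - b‖ = t) (hy : ‖y‖ ≤ C) (hxy : ‖y - x‖ ≤ ε) :
    ‖a * Complex.I * ((a - w)⁻¹ * x) - b * Complex.I * ((b - w)⁻¹ * y)‖ ≤
      2 * d⁻¹ * ε + ‖w‖ * t * (d⁻¹ * d⁻¹) * C := by
  have haw : a - w ≠ 0 := norm_pos_iff.1 (hd.trans_le ha)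
  have hbw : b - w ≠ 0 := norm_pos_iff.1 (hd.trans_le hb)
  have e : a * Complex.I * ((a - w)⁻¹ * x) - b * Complex.I * ((b - w)⁻¹ * y) =
      -(Complex.I * (a * (a - w)⁻¹ * (y - x))) +
        -(Complex.I * (w * (a - b) * ((a - w)⁻¹ * (b - w)⁻¹) * y)) := by
    field_simp
    ring
  rw [e]
  refine (norm_add_le _ _).trans ?_
  simp only [norm_neg, norm_mul, Complex.norm_I, one_mul, norm_inv, hab]
  have h0 : 0 ≤ t := hab ▸ norm_nonneg _
  gcongr

lemma tendsto_cauchyTransform_sub {ρ C : ℝ} (hρ : 0 < ρ) (hρ1 : ρ < 1) {φ G : ℂ → ℂ}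
    (hφ : ∀ ζ, ρ < ‖ζ‖ → ‖ζ‖ < 1 → DifferentiableAt ℂ φ ζ)
    (hG : ∀ ζ, 1 < ‖ζ‖ → ‖ζ‖ < ρ⁻¹ → DifferentiableAt ℂ G ζ)
    (hC : ∀ ζ, ρ < ‖ζ‖ → ‖ζ‖ < 1 → ‖φ ζ‖ ≤ C)
    (hlim : ∀ ε > 0, ∃ s < 1, ∀ ζ, s < ‖ζ‖ → ‖ζ‖ < 1 →
      ‖φ ζ - G ((starRingEnd ℂ) ζ)⁻¹‖ < ε) {w : ℂ} (hw : ‖w‖ ≠ 1) :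
    Tendsto (fun s : ℝ => cauchyTransform G s⁻¹ w - cauchyTransform φ s w) (𝓝[<] 1) (𝓝 0) := by
  set d := |1 - ‖w‖| / 2 with hd
  have hdpos : 0 < d := half_pos (abs_pos.2 (sub_ne_zero.2 hw.symm))
  have hid : Tendsto (fun s : ℝ => s) (𝓝[<] 1) (𝓝 1) := nhdsWithin_le_nhds
  have hinv : Tendsto (fun s : ℝ => s⁻¹) (𝓝[<] 1) (𝓝 1) := by
    simpa using hid.inv₀ one_ne_zero
  rw [Metric.tendsto_nhds]
  intro ε hε
  have h2pi : 0 < 2 * Real.pi := by positivity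
  obtain ⟨s₀, hs₀, hclose⟩ := hlim (ε / (2 * Real.pi) * d / 8) (by positivity)
  have e1 : ∀ᶠ s : ℝ in 𝓝[<] 1, d < |s - ‖w‖| :=
    ((hid.sub_const _).abs).eventually_const_lt (by linarith)
  have e2 : ∀ᶠ s : ℝ in 𝓝[<] 1, d < |s⁻¹ - ‖w‖| :=
    ((hinv.sub_const _).abs).eventually_const_lt (by linarith)
  have e3 : ∀ᶠ s : ℝ in 𝓝[<] 1, s⁻¹ < 2 := hinv.eventually_lt_const (by norm_num)
  have e4 : ∀ᶠ s : ℝ in 𝓝[<] 1,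
      ‖w‖ * (s⁻¹ - s) * (d⁻¹ * d⁻¹) * C < ε / (2 * Real.pi) / 2 := by
    have : Tendsto (fun s : ℝ => ‖w‖ * (s⁻¹ - s) * (d⁻¹ * d⁻¹) * C) (𝓝[<] 1)
        (𝓝 (‖w‖ * (1 - 1) * (d⁻¹ * d⁻¹) * C)) :=
      (((hinv.sub hid).const_mul _).mul_const _).mul_const _
    refine this.eventually_lt_const ?_
    simp only [sub_self, mul_zero, zero_mul]
    positivity
  have e5 : ∀ᶠ s : ℝ in 𝓝[<] 1, ρ < s := hid.eventually_const_lt hρ1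
  have e6 : ∀ᶠ s : ℝ in 𝓝[<] 1, s₀ < s := hid.eventually_const_lt hs₀
  filter_upwards [e1, e2, e3, e4, e5, e6, self_mem_nhdsWithin] with s h1 h2 h3 h4 h5 h6 h7
  rw [Set.mem_Iio] at h7
  have hs : 0 < s := hρ.trans h5
  have hs1 : 1 < s⁻¹ := (one_lt_inv₀ hs).2 h7
  have hsρ : s⁻¹ < ρ⁻¹ := (inv_lt_inv₀ hs hρ).2 h5
  have hcG := continuous_cauchyTransform_integrand (f := G) (inv_pos.2 hs) (w := w)
    (fun h => by rw [h, sub_self, abs_zero] at h2; linarith)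
    (fun ζ h => (hG ζ (by linarith) (by linarith)).continuousAt) 1
  have hcφ := continuous_cauchyTransform_integrand (f := φ) hs (w := w)
    (fun h => by rw [h, sub_self, abs_zero] at h1; linarith)
    (fun ζ h => (hφ ζ (by linarith) (by linarith)).continuousAt) 1
  simp only [pow_one] at hcG hcφ
  rw [dist_zero_right, cauchyTransform_eq_intervalIntegral, cauchyTransform_eq_intervalIntegral,
    ← intervalIntegral.integral_sub (hcG.intervalIntegrable _ _) (hcφ.intervalIntegrable _ _)]
  set K := 2 * d⁻¹ * (ε / (2 * Real.pi) * d / 8) + ‖w‖ * (s⁻¹ - s) * (d⁻¹ * d⁻¹) * C with hK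
  have hK2 : K < ε / (2 * Real.pi) := by
    have : 2 * d⁻¹ * (ε / (2 * Real.pi) * d / 8) = ε / (2 * Real.pi) / 4 := by
      field_simp
      norm_num
    have : 0 < ε / (2 * Real.pi) := by positivity
    linarith
  refine (intervalIntegral.norm_integral_le_of_norm_le_const (C := K) fun θ _ => ?_).trans_lt ?_
  · have hnb : ‖circleMap 0 s θ‖ = s := by rw [norm_circleMap_zero, abs_of_pos hs]
    have hna : ‖circleMap 0 s⁻¹ θ‖ = s⁻¹ := by rw [norm_circleMap_zero, abs_of_pos (inv_pos.2 hs)]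
    refine norm_integrand_sub_le hdpos
      (h2.le.trans (norm_circleMap_sub_ge _ _ (inv_pos.2 hs).le _))
      (h1.le.trans (norm_circleMap_sub_ge _ _ hs.le _)) (by linarith) ?_
      (hC _ (by linarith) (by linarith)) ?_
    · rw [circleMap_zero, circleMap_zero, ← sub_mul, norm_mul, Complex.norm_exp_ofReal_mul_I,
        mul_one, ← Complex.ofReal_sub, Complex.norm_real, Real.norm_of_nonneg (by linarith)]
    · rw [circleMap_inv_eq]
      exact (hclose _ (by linarith) (by linarith)).le
  · rw [sub_zero, abs_of_pos h2pi]
    exact (lt_div_iff₀ h2pi).1 hK2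

/-- Holomorphic functions on the two sides of the unit circle whose difference at mirror points
tends uniformly to `0` are restrictions of one holomorphic function. -/
lemma exists_differentiableAt_glue {ρ C : ℝ} (hρ : 0 < ρ) (hρ1 : ρ < 1) {φ G : ℂ → ℂ}
    (hφ : ∀ ζ, ρ < ‖ζ‖ → ‖ζ‖ < 1 → DifferentiableAt ℂ φ ζ)
    (hG : ∀ ζ, 1 < ‖ζ‖ → ‖ζ‖ < ρ⁻¹ → DifferentiableAt ℂ G ζ)
    (hC : ∀ ζ, ρ < ‖ζ‖ → ‖ζ‖ < 1 → ‖φ ζ‖ ≤ C)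
    (hlim : ∀ ε > 0, ∃ s < 1, ∀ ζ, s < ‖ζ‖ → ‖ζ‖ < 1 →
      ‖φ ζ - G ((starRingEnd ℂ) ζ)⁻¹‖ < ε) :
    ∃ H : ℂ → ℂ, ∃ r, ρ < r ∧ r < 1 ∧
      (∀ w, r < ‖w‖ → ‖w‖ < r⁻¹ → DifferentiableAt ℂ H w) ∧
      (∀ w, r < ‖w‖ → ‖w‖ < 1 → H w = φ w) ∧
      (∀ w, 1 < ‖w‖ → ‖w‖ < r⁻¹ → H w = G w) := by
  obtain ⟨r, hρr, hr1⟩ := exists_between hρ1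
  have hr : 0 < r := hρ.trans hρr
  have hrinv : 1 < r⁻¹ := (one_lt_inv₀ hr).2 hr1
  have hrρ : r⁻¹ < ρ⁻¹ := (inv_lt_inv₀ hr hρ).2 hρr
  have hpi : (2 * Real.pi * Complex.I : ℂ) ≠ 0 := Complex.two_pi_I_ne_zero
  have hid : Tendsto (fun s : ℝ => s) (𝓝[<] 1) (𝓝 1) := nhdsWithin_le_nhds
  have hinv : Tendsto (fun s : ℝ => s⁻¹) (𝓝[<] 1) (𝓝 1) := by
    simpa using hid.inv₀ one_ne_zero
  have hl : ∀ᶠ s : ℝ in 𝓝[<] 1, s < 1 := self_mem_nhdsWithin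
  refine ⟨fun w => (2 * Real.pi * Complex.I)⁻¹ *
    (cauchyTransform G r⁻¹ w - cauchyTransform φ r w), r, hρr, hr1, fun w h1 h2 => ?_,
    fun w h1 h2 => ?_, fun w h1 h2 => ?_⟩
  · refine DifferentiableAt.const_mul (DifferentiableAt.sub ?_ ?_) _
    · exact differentiableAt_cauchyTransform (inv_pos.2 hr) h2.ne
        fun ζ h => (hG ζ (by linarith) (by linarith)).continuousAt
    · exact differentiableAt_cauchyTransform hr h1.ne'
        fun ζ h => (hφ ζ (by linarith) (by linarith)).continuousAt
  · rw [inv_mul_eq_iff_eq_mul₀ hpi, ← sub_eq_zero]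
    refine tendsto_nhds_unique (f := fun _ : ℝ => cauchyTransform G r⁻¹ w -
      cauchyTransform φ r w - 2 * Real.pi * Complex.I * φ w) tendsto_const_nhds
      ((tendsto_cauchyTransform_sub hρ hρ1 hφ hG hC hlim h2.ne).congr' ?_)
    filter_upwards [hid.eventually_const_lt h2, hl] with s hs hs1
    have hspos : 0 < s := (norm_nonneg w).trans_lt hs
    have hs1' : 1 < s⁻¹ := (one_lt_inv₀ hspos).2 hs1
    have k1 := cauchyTransform_sub_cauchyTransform (f := φ) hr
      (fun ζ h3 h4 => hφ ζ (by linarith) (by linarith)) h1 hs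
    have k2 := cauchyTransform_eq_of_notMem (f := G) (inv_pos.2 hspos)
      ((inv_le_inv₀ hspos hr).2 (h1.trans hs).le) (w := w)
      (fun ζ h3 h4 => hG ζ (by linarith) (by linarith)) (Or.inl (by linarith))
    linear_combination -k2 - k1
  · rw [inv_mul_eq_iff_eq_mul₀ hpi, ← sub_eq_zero]
    refine tendsto_nhds_unique (f := fun _ : ℝ => cauchyTransform G r⁻¹ w -
      cauchyTransform φ r w - 2 * Real.pi * Complex.I * G w) tendsto_const_nhds
      ((tendsto_cauchyTransform_sub hρ hρ1 hφ hG hC hlim h1.ne').congr' ?_)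
    filter_upwards [hinv.eventually_lt_const h1, hid.eventually_const_lt hr1, hl] with s hs hrs hs1
    have hspos : 0 < s := hr.trans hrs
    have hs1' : 1 < s⁻¹ := (one_lt_inv₀ hspos).2 hs1
    have k1 := cauchyTransform_sub_cauchyTransform (f := G) (inv_pos.2 hspos)
      (fun ζ h3 h4 => hG ζ (by linarith) (by linarith)) hs h2
    have k2 := cauchyTransform_eq_of_notMem (f := φ) hr hrs.le (w := w)
      (fun ζ h3 h4 => hφ ζ (by linarith) (by linarith)) (Or.inr (by linarith))
    linear_combination -k1 - k2

lemma coe_mem_sphereUnitDisk {w : ℂ} : (w : OnePoint ℂ) ∈ sphereUnitDisk ↔ ‖w‖ < 1 := by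
  simp [sphereUnitDisk]

lemma infty_notMem_sphereUnitDisk : (∞ : OnePoint ℂ) ∉ sphereUnitDisk := by
  simp [sphereUnitDisk]

lemma isOpen_sphereUnitDisk : IsOpen sphereUnitDisk :=
  OnePoint.isOpenEmbedding_coe.isOpenMap _ Metric.isOpen_ball

lemma sphereInvConj_coe_of_ne {w : ℂ} (hw : w ≠ 0) :
    sphereInvConj (w : OnePoint ℂ) = ((((starRingEnd ℂ) w)⁻¹ : ℂ) : OnePoint ℂ) := by
  rw [sphereInvConj_apply, sphereConj_coe, sphereInv_coe_of_ne]
  simpa using hw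

lemma sphereInvConj_infty : sphereInvConj ∞ = ((0 : ℂ) : OnePoint ℂ) := rfl

lemma sphereInvConj_coe_mem_sphereUnitDisk {w : ℂ} :
    sphereInvConj (w : OnePoint ℂ) ∈ sphereUnitDisk ↔ 1 < ‖w‖ := by
  by_cases hw : w = 0
  · subst hw
    simp [sphereInvConj_apply, infty_notMem_sphereUnitDisk]
  · rw [sphereInvConj_coe_of_ne hw, coe_mem_sphereUnitDisk, norm_inv, Complex.norm_conj,
      inv_lt_one₀ (norm_pos_iff.2 hw)]

lemma sphereInvConj_notMem_sphereUnitDisk {p : OnePoint ℂ} (hp : p ∈ sphereUnitDisk) :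
    sphereInvConj p ∉ sphereUnitDisk := by
  induction p using OnePoint.rec with
  | infty => exact absurd hp infty_notMem_sphereUnitDisk
  | coe w =>
    rw [sphereInvConj_coe_mem_sphereUnitDisk, not_lt]
    exact (coe_mem_sphereUnitDisk.1 hp).le

lemma continuousAt_sphereCoord {p : OnePoint ℂ} (hp : p ≠ ∞) : ContinuousAt sphereCoord p := by
  obtain ⟨z, rfl⟩ := OnePoint.ne_infty_iff_exists.1 hp
  exact OnePoint.continuousAt_coe.2 continuousAt_id

lemma coe_sphereCoord {p : OnePoint ℂ} (hp : p ≠ ∞) : ((sphereCoord p : ℂ) : OnePoint ℂ) = p := by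
  obtain ⟨z, rfl⟩ := OnePoint.ne_infty_iff_exists.1 hp
  rfl

lemma continuous_sphereConj : Continuous sphereConj := by
  have h : sphereConj = Complex.conjCLE.toHomeomorph.onePointCongr := by
    funext p
    induction p using OnePoint.rec <;> rfl
  rw [h]
  exact Homeomorph.continuous _

/-- A function that agrees with conjugation on the boundary of a domain containing `∞` is, near the
boundary, finite and uniformly close to conjugation. -/
lemma exists_isCompact_subset_forall_norm_sub_lt {Ω : Set (OnePoint ℂ)} (hΩ : IsOpen Ω)
    (hinf : ∞ ∈ Ω) {f : OnePoint ℂ → OnePoint ℂ} (hf : ContinuousOn f (closure Ω))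
    (hbdry : ∀ z ∈ frontier Ω, f z = sphereConj z) :
    ∃ C : ℝ, ∀ ε > 0, ∃ B ⊆ Ω, IsCompact B ∧ ∀ z ∈ Ω, z ∉ B → z ≠ ∞ ∧ f z ≠ ∞ ∧
      ‖sphereCoord z‖ ≤ C ∧ ‖sphereCoord z - (starRingEnd ℂ) (sphereCoord (f z))‖ < ε := by
  have hfin : ∀ z ∈ frontier Ω, z ≠ ∞ := by
    rintro z hz rfl
    rw [hΩ.frontier_eq] at hz
    exact hz.2 hinf
  obtain ⟨C, hC⟩ := isClosed_frontier.isCompact.exists_bound_of_continuousOn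
    (s := frontier Ω) (f := sphereCoord)
    fun z hz => (continuousAt_sphereCoord (hfin z hz)).continuousWithinAt
  refine ⟨C + 1, fun ε hε => ?_⟩
  set P : OnePoint ℂ → Prop := fun z => z ≠ ∞ ∧ f z ≠ ∞ ∧
      ‖sphereCoord z‖ ≤ C + 1 ∧ ‖sphereCoord z - (starRingEnd ℂ) (sphereCoord (f z))‖ < ε with hP
  have hloc : ∀ z ∈ frontier Ω, ∀ᶠ y in 𝓝[closure Ω] z, P y := by
    intro z hz
    have hz1 := hfin z hz
    have hfz := hbdry z hz
    have hz2 : f z ≠ ∞ := by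
      obtain ⟨x, rfl⟩ := OnePoint.ne_infty_iff_exists.1 hz1
      rw [hfz, sphereConj_coe]
      exact OnePoint.coe_ne_infty _
    have c1 : Tendsto sphereCoord (𝓝[closure Ω] z) (𝓝 (sphereCoord z)) :=
      (continuousAt_sphereCoord hz1).mono_left nhdsWithin_le_nhds
    have c2 : Tendsto f (𝓝[closure Ω] z) (𝓝 (f z)) := hf z (frontier_subset_closure hz)
    have c3 : Tendsto (fun y => sphereCoord (f y)) (𝓝[closure Ω] z) (𝓝 (sphereCoord (f z))) :=
      (continuousAt_sphereCoord hz2).tendsto.comp c2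
    have c4 : Tendsto (fun y => ‖sphereCoord y - (starRingEnd ℂ) (sphereCoord (f y))‖)
        (𝓝[closure Ω] z) (𝓝 0) := by
      have h := (c1.sub ((Complex.continuous_conj.tendsto _).comp c3)).norm
      simpa [hfz, sphereCoord_sphereConj] using h
    have c5 : Tendsto (fun y : OnePoint ℂ => y) (𝓝[closure Ω] z) (𝓝 z) := nhdsWithin_le_nhds
    filter_upwards [c5.eventually_ne hz1, c2.eventually_ne hz2,
      c1.norm.eventually_lt_const (lt_of_le_of_lt (hC z hz) (lt_add_one C)),
      c4.eventually_lt_const hε] with y h1 h2 h3 h4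
    exact ⟨h1, h2, h3.le, h4⟩
  have hV : ∀ z ∈ frontier Ω, ∃ V, IsOpen V ∧ z ∈ V ∧ V ∩ closure Ω ⊆ {y | P y} := fun z hz => by
    obtain ⟨V, hVo, hzV, hVP⟩ := mem_nhdsWithin.1 (hloc z hz)
    exact ⟨V, hVo, hzV, hVP⟩
  choose! V hVo hzV hVP using hV
  have hW : IsOpen (⋃ z ∈ frontier Ω, V z) := isOpen_biUnion hVo
  refine ⟨closure Ω \ ⋃ z ∈ frontier Ω, V z, fun z hz => ?_,
    (isClosed_closure.sdiff hW).isCompact, fun z hz hzB => ?_⟩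
  · by_contra hzΩ
    have : z ∈ frontier Ω := by
      rw [hΩ.frontier_eq]
      exact ⟨hz.1, hzΩ⟩
    exact hz.2 (Set.mem_biUnion this (hzV z this))
  · have : z ∈ ⋃ z ∈ frontier Ω, V z := by
      by_contra h
      exact hzB ⟨subset_closure hz, h⟩
    obtain ⟨y, hy, hzy⟩ := Set.mem_iUnion₂.1 this
    exact hVP y hy ⟨hzy, subset_closure hz⟩

/-- Schwarz reflection of a uniformizing map `φ` of a domain containing `∞`. -/
lemma exists_reflection_of_infty_mem {Ω : Set (OnePoint ℂ)} (hΩ : IsOpen Ω)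
    (hinf : ∞ ∈ Ω) {f φ : OnePoint ℂ → OnePoint ℂ} (hf : ContinuousOn f (closure Ω))
    (hfhol : ∀ p ∈ Ω, SphereHolomorphicAt f p) (hbdry : ∀ z ∈ frontier Ω, f z = sphereConj z)
    (hφ : ∀ p ∈ sphereUnitDisk, SphereHolomorphicAt φ p)
    (hmaps : Set.MapsTo φ sphereUnitDisk Ω)
    (hproper : ∀ B ⊆ Ω, IsCompact B → ∃ s < 1, ∀ w : ℂ, ‖w‖ < 1 → φ w ∈ B → ‖w‖ ≤ s) :
    ∃ R : OnePoint ℂ → OnePoint ℂ, (∀ p, SphereHolomorphicAt R p) ∧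
      Set.EqOn R φ sphereUnitDisk ∧
      ∀ w ∈ sphereUnitDisk, sphereConj (f (φ w)) = R (sphereInvConj w) := by
  obtain ⟨C, hC⟩ := exists_isCompact_subset_forall_norm_sub_lt hΩ hinf hf hbdry
  have hnear : ∀ ε > 0, ∃ s < 1, ∀ w : ℂ, s < ‖w‖ → ‖w‖ < 1 → φ w ≠ ∞ ∧ f (φ w) ≠ ∞ ∧
      ‖sphereCoord (φ w)‖ ≤ C ∧
      ‖sphereCoord (φ w) - (starRingEnd ℂ) (sphereCoord (f (φ w)))‖ < ε := by
    intro ε hε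
    obtain ⟨B, hBΩ, hB, hBP⟩ := hC ε hε
    obtain ⟨s, hs, hsB⟩ := hproper B hBΩ hB
    exact ⟨s, hs, fun w h1 h2 => hBP _ (hmaps (coe_mem_sphereUnitDisk.2 h2))
      fun h => absurd (hsB w h2 h) (not_le.2 h1)⟩
  obtain ⟨s₁, hs₁, hnear₁⟩ := hnear 1 one_pos
  set ρ := max s₁ (1 / 2) with hρ
  have hρ0 : 0 < ρ := lt_of_lt_of_le (by norm_num) (le_max_right _ _)
  have hρ1 : ρ < 1 := max_lt hs₁ (by norm_num)
  have hfin : ∀ w : ℂ, ρ < ‖w‖ → ‖w‖ < 1 → φ w ≠ ∞ ∧ f (φ w) ≠ ∞ ∧ ‖sphereCoord (φ w)‖ ≤ C :=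
    fun w h1 h2 =>
      have h := hnear₁ w ((le_max_left _ _).trans_lt h1) h2
      ⟨h.1, h.2.1, h.2.2.1⟩
  have hfφ : ∀ p ∈ sphereUnitDisk, SphereHolomorphicAt (f ∘ φ) p := fun p hp =>
    (hfhol _ (hmaps hp)).comp (hφ p hp)
  set g : ℂ → ℂ := fun w => sphereCoord ((f ∘ φ) w) with hg
  set G : ℂ → ℂ := fun ζ => (starRingEnd ℂ) (g ((starRingEnd ℂ) ζ⁻¹)) with hG
  have hmirror : ∀ ζ : ℂ, 1 < ‖ζ‖ → ‖ζ‖ < ρ⁻¹ →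
      ρ < ‖(starRingEnd ℂ) ζ⁻¹‖ ∧ ‖(starRingEnd ℂ) ζ⁻¹‖ < 1 := by
    intro ζ h1 h2
    rw [Complex.norm_conj, norm_inv]
    exact ⟨(lt_inv_comm₀ hρ0 (by linarith)).2 h2, inv_lt_one_of_one_lt₀ h1⟩
  obtain ⟨H, r, hρr, hr1, hH, hHφ, hHG⟩ := exists_differentiableAt_glue (C := C) hρ0 hρ1
    (φ := fun w => sphereCoord (φ w)) (G := G)
    (fun ζ h1 h2 => ((hφ _ (coe_mem_sphereUnitDisk.2 h2)).analyticAt_sphereCoord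
      (hfin ζ h1 h2).1).differentiableAt)
    (fun ζ h1 h2 => by
      obtain ⟨h3, h4⟩ := hmirror ζ h1 h2
      have h5 := ((hfφ _ (coe_mem_sphereUnitDisk.2 h4)).analyticAt_sphereCoord
        (hfin _ h3 h4).2.1).conj_conj
      rw [Complex.conj_conj] at h5
      have hne : ζ ≠ 0 := by
        rintro rfl
        simp at h1
        linarith
      exact (h5.differentiableAt).comp ζ (differentiableAt_inv hne))
    (fun ζ h1 h2 => (hfin ζ h1 h2).2.2)
    (fun ε hε => by
      obtain ⟨s, hs, h⟩ := hnear ε hε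
      refine ⟨s, hs, fun ζ h1 h2 => ?_⟩
      simpa [hG, hg] using (h ζ h1 h2).2.2.2)
  have hr0 : 0 < r := hρ0.trans hρr
  set R : OnePoint ℂ → OnePoint ℂ := fun p =>
    if p ∈ sphereUnitDisk then φ p
    else if sphereInvConj p ∈ sphereUnitDisk then sphereConj (f (φ (sphereInvConj p)))
    else ((H (sphereCoord p) : ℂ) : OnePoint ℂ) with hR
  have hR1 : Set.EqOn R φ sphereUnitDisk := fun p hp => if_pos hp
  have hR2 : ∀ p, sphereInvConj p ∈ sphereUnitDisk →
      R p = sphereConj (f (φ (sphereInvConj p))) := by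
    intro p hp
    have hp' : p ∉ sphereUnitDisk := fun h => sphereInvConj_notMem_sphereUnitDisk h hp
    simp only [hR, if_neg hp', if_pos hp]
  have hR3 : ∀ w : ℂ, r < ‖w‖ → ‖w‖ < r⁻¹ → R w = ((H w : ℂ) : OnePoint ℂ) := by
    intro w h1 h2
    rcases lt_trichotomy ‖w‖ 1 with h | h | h
    · rw [hR1 (coe_mem_sphereUnitDisk.2 h), hHφ w h1 h,
        coe_sphereCoord (hfin w (hρr.trans h1) h).1]
    · have h3 : (w : OnePoint ℂ) ∉ sphereUnitDisk := by simp [coe_mem_sphereUnitDisk, h]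
      have h4 : sphereInvConj (w : OnePoint ℂ) ∉ sphereUnitDisk := by
        simp [sphereInvConj_coe_mem_sphereUnitDisk, h]
      simp only [hR, if_neg h3, if_neg h4, sphereCoord_coe]
    · have hne : w ≠ 0 := norm_pos_iff.1 (hr0.trans h1)
      obtain ⟨h3, h4⟩ := hmirror w h (h2.trans ((inv_lt_inv₀ hr0 hρ0).2 hρr))
      have h5 := (hfin _ h3 h4).2.1
      rw [hR2 _ (sphereInvConj_coe_mem_sphereUnitDisk.2 h), hHG w h h2,
        sphereInvConj_coe_of_ne hne, ← map_inv₀, ← coe_sphereCoord h5, sphereConj_coe]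
      rfl
  refine ⟨R, fun p => ?_, hR1, fun w hw => ?_⟩
  · by_cases hp : p ∈ sphereUnitDisk
    · exact (hφ p hp).congr (hR1.eventuallyEq_of_mem (isOpen_sphereUnitDisk.mem_nhds hp))
    by_cases hp2 : sphereInvConj p ∈ sphereUnitDisk
    · have hcomm : ∀ q, sphereInvConj q = sphereConj (sphereInv q) := fun q => by
        rw [sphereInvConj_apply, sphereConj_sphereInv]
      have h1 := (hfφ _ hp2).conj_conj
      rw [hcomm, sphereConj_sphereConj] at h1
      refine (h1.comp (sphereHolomorphicAt_sphereInv p)).congr ?_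
      have hcont : Continuous sphereInvConj := by
        have : sphereInvConj = sphereInv ∘ sphereConj := rfl
        exact sphereInvHomeomorph.continuous.comp continuous_sphereConj
      filter_upwards [(isOpen_sphereUnitDisk.preimage hcont).mem_nhds hp2] with q hq
      rw [hR2 q hq, hcomm]
      rfl
    · induction p using OnePoint.rec with
      | infty =>
        exact absurd (by rw [sphereInvConj_infty, coe_mem_sphereUnitDisk]; simp) hp2
      | coe w =>
        rw [coe_mem_sphereUnitDisk, not_lt] at hp
        rw [sphereInvConj_coe_mem_sphereUnitDisk, not_lt] at hp2
        have hrinv : 1 < r⁻¹ := (one_lt_inv₀ hr0).2 hr1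
        have hopen : IsOpen {w : ℂ | r < ‖w‖ ∧ ‖w‖ < r⁻¹} :=
          (isOpen_lt continuous_const continuous_norm).inter
            (isOpen_lt continuous_norm continuous_const)
        have hmem : {w : ℂ | r < ‖w‖ ∧ ‖w‖ < r⁻¹} ∈ 𝓝 w :=
          hopen.mem_nhds ⟨by linarith, by linarith⟩
        refine SphereHolomorphicAt.of_coe (F := H) ?_ ?_
        · rw [Complex.analyticAt_iff_eventually_differentiableAt]
          filter_upwards [hmem] with y hy using hH y hy.1 hy.2
        · filter_upwards [hmem] with y hy using hR3 y hy.1 hy.2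
  · rw [hR2 _ (by rwa [sphereInvConj_sphereInvConj]), sphereInvConj_sphereInvConj]

/-- A uniformization of a simply connected domain of the sphere that omits two points. -/
lemma exists_sphere_riemann_map {Ω : Set (OnePoint ℂ)} (hΩ : IsOpen Ω)
    (hsc : IsSimplyConnected Ω) (hcompl : Set.Nontrivial Ωᶜ) :
    ∃ φ : OnePoint ℂ → OnePoint ℂ, (∀ p ∈ sphereUnitDisk, SphereHolomorphicAt φ p) ∧
      Set.InjOn φ sphereUnitDisk ∧ φ '' sphereUnitDisk = Ω ∧
      ∀ B ⊆ Ω, IsCompact B → ∃ s < 1, ∀ w : ℂ, ‖w‖ < 1 → φ w ∈ B → ‖w‖ ≤ s := by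
  obtain ⟨a, ha, b, hb, hab⟩ : ∃ a : ℂ, (a : OnePoint ℂ) ∉ Ω ∧ ∃ b, b ∉ Ω ∧
      (a : OnePoint ℂ) ≠ b := by
    obtain ⟨x, hx, y, hy, hxy⟩ := hcompl
    by_cases hx0 : x = ∞
    · obtain ⟨a, rfl⟩ := OnePoint.ne_infty_iff_exists.1 (fun h : y = ∞ => hxy (hx0.trans h.symm))
      exact ⟨a, hy, x, hx, hxy.symm⟩
    · obtain ⟨a, rfl⟩ := OnePoint.ne_infty_iff_exists.1 hx0
      exact ⟨a, hx, y, hy, hxy⟩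
  set N := spherePoleAt a with hN
  have hNa : N (a : OnePoint ℂ) = ∞ := spherePoleAt_self a
  have hNfin : ∀ p ∈ Ω, N p ≠ ∞ := by
    intro p hp h
    rw [← hNa] at h
    exact ha (N.injective h ▸ hp)
  set U : Set ℂ := {z | N.symm (z : OnePoint ℂ) ∈ Ω} with hU
  have hUo : IsOpen U := hΩ.preimage (N.symm.continuous.comp OnePoint.continuous_coe)
  have himg : (fun z : ℂ => (z : OnePoint ℂ)) '' U = N '' Ω := by
    ext p
    constructor
    · rintro ⟨z, hz, rfl⟩
      exact ⟨_, hz, N.apply_symm_apply _⟩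
    · rintro ⟨q, hq, rfl⟩
      refine ⟨sphereCoord (N q), ?_, coe_sphereCoord (hNfin q hq)⟩
      rw [hU, Set.mem_ofPred_eq, coe_sphereCoord (hNfin q hq), N.symm_apply_apply]
      exact hq
  have hUsc : IsSimplyConnected U := by
    rw [← (OnePoint.isOpenEmbedding_coe (X := ℂ)).isEmbedding.isSimplyConnected_image]
    change IsSimplyConnected ((fun z : ℂ => (z : OnePoint ℂ)) '' U)
    rw [himg]
    exact N.isSimplyConnected_image.2 hsc
  have hUne : U ≠ Set.univ := by
    intro h
    have hNb : N b ≠ ∞ := fun h => hab (N.injective (hNa.trans h.symm))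
    have h1 : sphereCoord (N b) ∈ U := h ▸ Set.mem_univ _
    rw [hU, Set.mem_ofPred_eq, coe_sphereCoord hNb, N.symm_apply_apply] at h1
    exact hb h1
  obtain ⟨F, ψ, hF, hψ, hFm, hψm, hψF, hFψ⟩ := exists_riemann_map hUo hUsc hUne
  have hdisk : ∀ p ∈ sphereUnitDisk, ∃ w ∈ Metric.ball (0 : ℂ) 1, (w : OnePoint ℂ) = p :=
    fun p hp => hp
  refine ⟨fun p => N.symm ((ψ (sphereCoord p) : ℂ) : OnePoint ℂ), ?_, ?_, ?_, ?_⟩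
  · intro p hp
    obtain ⟨w, hw, rfl⟩ := hdisk p hp
    have h1 : SphereHolomorphicAt (fun p => ((ψ (sphereCoord p) : ℂ) : OnePoint ℂ))
        (w : OnePoint ℂ) :=
      SphereHolomorphicAt.of_coe (hψ.analyticAt (Metric.isOpen_ball.mem_nhds hw))
        (Eventually.of_forall fun _ => rfl)
    exact (sphereHolomorphicAt_spherePoleAt_symm a _).comp h1
  · intro p hp q hq h
    obtain ⟨w, hw, rfl⟩ := hdisk p hp
    obtain ⟨v, hv, rfl⟩ := hdisk q hq
    have h1 : ψ w = ψ v := OnePoint.coe_injective (N.symm.injective h)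
    rw [hFψ.injOn hw hv h1]
  · ext p
    constructor
    · rintro ⟨q, hq, rfl⟩
      obtain ⟨w, hw, rfl⟩ := hdisk q hq
      exact hψm hw
    · intro hp
      have h1 : sphereCoord (N p) ∈ U := by
        rw [hU, Set.mem_ofPred_eq, coe_sphereCoord (hNfin p hp), N.symm_apply_apply]
        exact hp
      refine ⟨((F (sphereCoord (N p)) : ℂ) : OnePoint ℂ), ⟨_, hFm h1, rfl⟩, ?_⟩
      change N.symm ((ψ (F (sphereCoord (N p))) : ℂ) : OnePoint ℂ) = p
      rw [hψF h1, coe_sphereCoord (hNfin p hp), N.symm_apply_apply]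
  · intro B hBΩ hB
    have hmaps : ∀ p ∈ B, sphereCoord (N p) ∈ U := by
      intro p hp
      rw [hU, Set.mem_ofPred_eq, coe_sphereCoord (hNfin p (hBΩ hp)), N.symm_apply_apply]
      exact hBΩ hp
    have hcont : ContinuousOn (fun p => ‖F (sphereCoord (N p))‖) B := by
      refine (hF.comp (fun p hp => ?_) hmaps).norm
      exact ((continuousAt_sphereCoord (hNfin p (hBΩ hp))).comp
        N.continuous.continuousAt).continuousWithinAt
    have hval : ∀ w : ℂ, ‖w‖ < 1 → F (sphereCoord (N (N.symm ((ψ w : ℂ) : OnePoint ℂ)))) = w := by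
      intro w hw
      rw [N.apply_symm_apply]
      exact hFψ (by simpa using hw)
    rcases B.eq_empty_or_nonempty with rfl | hne
    · exact ⟨0, one_pos, fun w _ h => absurd h (Set.notMem_empty _)⟩
    · obtain ⟨p, hp, hmax⟩ := hB.exists_isMaxOn hne hcont
      refine ⟨‖F (sphereCoord (N p))‖, by simpa using hFm (hmaps p hp), fun w hw h => ?_⟩
      have h2 := hmax h
      simp only [Set.mem_ofPred_eq, sphereCoord_coe] at h2
      rwa [hval w hw] at h2

/-- Schwarz reflection of a uniformizing map. -/
lemma exists_reflection {Ω : Set (OnePoint ℂ)} (hΩ : IsOpen Ω) (hne : Ω.Nonempty)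
    {f φ : OnePoint ℂ → OnePoint ℂ} (hf : ContinuousOn f (closure Ω))
    (hfhol : ∀ p ∈ Ω, SphereHolomorphicAt f p) (hbdry : ∀ z ∈ frontier Ω, f z = sphereConj z)
    (hφ : ∀ p ∈ sphereUnitDisk, SphereHolomorphicAt φ p)
    (hmaps : Set.MapsTo φ sphereUnitDisk Ω)
    (hproper : ∀ B ⊆ Ω, IsCompact B → ∃ s < 1, ∀ w : ℂ, ‖w‖ < 1 → φ w ∈ B → ‖w‖ ≤ s) :
    ∃ R : OnePoint ℂ → OnePoint ℂ, (∀ p, SphereHolomorphicAt R p) ∧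
      Set.EqOn R φ sphereUnitDisk ∧
      ∀ w ∈ sphereUnitDisk, sphereConj (f (φ w)) = R (sphereInvConj w) := by
  by_cases hinf : ∞ ∈ Ω
  · exact exists_reflection_of_infty_mem hΩ hinf hf hfhol hbdry hφ hmaps hproper
  obtain ⟨p, hp⟩ := hne
  obtain ⟨c, rfl⟩ := OnePoint.ne_infty_iff_exists.1 (fun h : p = ∞ => hinf (h ▸ hp))
  set M := spherePoleAt c with hM
  set M' := spherePoleAt ((starRingEnd ℂ) c) with hM'
  have hMM' : ∀ p, sphereConj (M p) = M' (sphereConj p) := sphereConj_spherePoleAt c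
  have hM'M : ∀ p, sphereConj (M' p) = M (sphereConj p) := fun p => by
    rw [hM', sphereConj_spherePoleAt, Complex.conj_conj]
  obtain ⟨R, hR, hRφ, hRf⟩ := exists_reflection_of_infty_mem (Ω := M '' Ω)
    (f := M' ∘ f ∘ M.symm) (φ := M ∘ φ) (M.isOpenMap Ω hΩ) ⟨_, hp, spherePoleAt_self c⟩
    (by
      rw [← M.image_closure]
      refine M'.continuous.comp_continuousOn (hf.comp M.symm.continuous.continuousOn ?_)
      rintro _ ⟨z, hz, rfl⟩
      rwa [M.symm_apply_apply])
    (by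
      rintro _ ⟨z, hz, rfl⟩
      refine (sphereHolomorphicAt_spherePoleAt _ _).comp (SphereHolomorphicAt.comp ?_
        (sphereHolomorphicAt_spherePoleAt_symm c _))
      rw [M.symm_apply_apply]
      exact hfhol z hz)
    (by
      rw [← M.image_frontier]
      rintro _ ⟨z, hz, rfl⟩
      simp only [Function.comp_apply, M.symm_apply_apply, hbdry z hz, hMM'])
    (fun p hp => (sphereHolomorphicAt_spherePoleAt _ _).comp (hφ p hp))
    (fun p hp => ⟨_, hmaps hp, rfl⟩)
    (fun B hBΩ hB => by
      obtain ⟨s, hs, h⟩ := hproper (M ⁻¹' B) (fun z hz => by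
        obtain ⟨y, hy, hyz⟩ := hBΩ hz
        exact M.injective hyz ▸ hy) (M.isCompact_preimage.2 hB)
      exact ⟨s, hs, fun w hw hwB => h w hw hwB⟩)
  refine ⟨M.symm ∘ R, fun p => (sphereHolomorphicAt_spherePoleAt_symm c _).comp (hR p),
    fun p hp => ?_, fun w hw => ?_⟩
  · simp [hRφ hp]
  · have h := hRf w hw
    simp only [Function.comp_apply, M.symm_apply_apply, hM'M] at h
    rw [Function.comp_apply, ← h, M.symm_apply_apply]

/-- Lemma 4.1 of the paper (a form of the Aharonov–Shapiro characterization of quadrature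
domains): if `Ω ⊊ ℂ̂` is a simply connected domain whose complement has at least two
points and whose boundary is locally connected, and `f : Ω̄ → ℂ̂` is continuous,
meromorphic on `Ω`, and equals complex conjugation `ι` on `∂Ω`, then there is a
rational map `R` carrying `𝔻` univalently onto `Ω` with
`ι ∘ f = R ∘ η⁻ ∘ (R|_𝔻)⁻¹` on `Ω`. -/
theorem quadrature_domain_uniformization
    (Ω : Set (OnePoint ℂ)) (hopen : IsOpen Ω) (hconn : IsConnected Ω)
    (hsc : SimplyConnectedSpace Ω)
    (hcompl : Set.Nontrivial Ωᶜ)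
    (hlc : LocallyConnectedSpace (frontier Ω))
    (f : OnePoint ℂ → OnePoint ℂ)
    (hf_cont : ContinuousOn f (closure Ω))
    (hf_mero : ∀ p ∈ Ω, SphereHolomorphicAt f p)
    (hf_bdry : ∀ z ∈ frontier Ω, f z = sphereConj z) :
    ∃ R : OnePoint ℂ → OnePoint ℂ,
      IsRationalMap R ∧
      Set.InjOn R sphereUnitDisk ∧
      R '' sphereUnitDisk = Ω ∧
      ∀ z ∈ Ω, ∀ w ∈ sphereUnitDisk, R w = z →
        sphereConj (f z) = R (sphereInvConj w) := by
  obtain ⟨φ, hφ, hinj, himg, hproper⟩ := exists_sphere_riemann_map hopen hsc hcompl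
  obtain ⟨R, hR, hRφ, hRf⟩ := exists_reflection hopen hconn.nonempty hf_cont hf_mero hf_bdry hφ
    (fun p hp => himg ▸ Set.mem_image_of_mem φ hp) hproper
  have hRinj : Set.InjOn R sphereUnitDisk := hinj.congr hRφ.symm
  refine ⟨R, ⟨hR, fun c hc => ?_⟩, hRinj, hRφ.image_eq.trans himg, fun z _ w hw hwz => ?_⟩
  · have h0 : ((0 : ℂ) : OnePoint ℂ) ∈ sphereUnitDisk := by simp [coe_mem_sphereUnitDisk]
    have h1 : ((1 / 2 : ℂ) : OnePoint ℂ) ∈ sphereUnitDisk := by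
      rw [coe_mem_sphereUnitDisk]
      norm_num
    have h2 := OnePoint.coe_injective (hRinj h0 h1 (by simp only [hc]))
    norm_num at h2
  · rw [← hwz, hRφ hw]
    exact hRf w hw
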